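/- Let d ≥ 4, 1 < p ≤ 2 and λ ≥ 2. Let j ≥ 1 and let E_j ⊂ ([2^j,2^{j+1}) ∩ ℕ) × ℤ^d be finite with #(E_j ∩ Q) ≤ λ^p l(Q) for every Q ∈ D_j. Then ‖ Σ_{(n,z) ∈ E_j} B_{n,z} ‖_{L^2(ℝ^d)}^2 ≤ C λ^{2p/(d−1)} #E_j, where B_{n,z} = K_n ∗ b_{n,z} with |b_{n,z}| ≤ χ_{q_z}, and C is independent of j, λ, E_j and the functions b_{n,z}. -/

import Mathlib

open MeasureTheory Real Set
open scoped Classical FourierTransform RealInnerProductSpace NNReal ENNReal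

noncomputable section

/-- Euclidean space `ℝ^d`. -/
abbrev Rd (d : ℕ) := EuclideanSpace ℝ (Fin d)

/-- `a` is a "distance function": smooth away from the origin, positive away from the
origin, and homogeneous of degree one. -/
structure IsDistFn {d : ℕ} (a : Rd d → ℝ) : Prop where
  smooth : ContDiffOn ℝ (⊤ : ℕ∞) a {ξ : Rd d | ξ ≠ 0}
  pos : ∀ ξ : Rd d, ξ ≠ 0 → 0 < a ξ
  homog : ∀ t : ℝ, 0 < t → ∀ ξ : Rd d, a (t • ξ) = t * a ξ

/-- Nonvanishing Gaussian curvature of the cosphere `Σ = {a = 1}`: at every point `ξ` of `Σ`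
the second fundamental form, i.e. the Hessian of `a` restricted to the tangent space
`ker (da(ξ))`, is nondegenerate. -/
def CurvNondeg {d : ℕ} (a : Rd d → ℝ) : Prop :=
  ∀ ξ : Rd d, a ξ = 1 → ∀ v : Rd d, fderiv ℝ a ξ v = 0 → v ≠ 0 →
    ∃ w : Rd d, fderiv ℝ a ξ w = 0 ∧ iteratedFDeriv ℝ 2 a ξ ![v, w] ≠ 0

/-- The bump function `η`: smooth, supported in `[1/8,8]`, equal to `1` on `[1/4,4]`. -/
structure IsBump (η : ℝ → ℝ) : Prop where
  smooth : ContDiff ℝ (⊤ : ℕ∞) η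
  supp : ∀ x : ℝ, x ∉ Icc (1/8 : ℝ) 8 → η x = 0
  one : ∀ x ∈ Icc (1/4 : ℝ) 4, η x = 1

/-- The kernel `K_r`, given by the inverse Fourier transform of `ξ ↦ η(a(ξ)) e^{i r a(ξ)}`. -/
def Kker {d : ℕ} (a : Rd d → ℝ) (η : ℝ → ℝ) (r : ℝ) (x : Rd d) : ℂ :=
  ∫ ξ : Rd d, (η (a ξ) : ℂ) * Complex.exp (Complex.I * r * a ξ) *
    Complex.exp (2 * π * Complex.I * (inner ℝ x ξ : ℝ))

/-- Convolution `K ∗ b`. -/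
def conv {d : ℕ} (K b : Rd d → ℂ) (x : Rd d) : ℂ := ∫ y, K (x - y) * b y

/-- The measure `ν_d` on `ℝ`, `dν_d(r) = (1+|r|)^{d-1} dr`. -/
def nuMeas (d : ℕ) : Measure ℝ :=
  volume.withDensity fun r => ENNReal.ofReal ((1 + |r|) ^ (d - 1))

/-- The Lorentz quasinorm `‖f‖_{L^{p,q}(μ)}`. -/
def lorentzNorm {α : Type*} {E : Type*} [MeasurableSpace α] [NormedAddCommGroup E]
    (μ : Measure α) (p : ℝ) (q : ℝ≥0∞) (f : α → E) : ℝ≥0∞ :=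
  if q = ∞ then ⨆ t : ℝ, ENNReal.ofReal t * μ {x | t < ‖f x‖} ^ (1 / p)
  else (∫⁻ t in Ioi (0 : ℝ),
      (ENNReal.ofReal t * μ {x | t < ‖f x‖} ^ (1 / p)) ^ q.toReal / ENNReal.ofReal t) ^
      (1 / q.toReal)

/-- The unit cube `q_z = ∏ [z_i, z_i + 1)`. -/
def qcube (d : ℕ) (z : Fin d → ℤ) : Set (Rd d) :=
  {y : Rd d | ∀ i, (z i : ℝ) ≤ y i ∧ y i < z i + 1}

/-- A normalized function `b_{n,z}`: measurable, bounded by the characteristic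
function of `q_z`. -/
def IsNormalized {d : ℕ} (z : Fin d → ℤ) (b : Rd d → ℂ) : Prop :=
  Measurable b ∧ (∀ y, ‖b y‖ ≤ 1) ∧ ∀ y ∉ qcube d z, b y = 0

/-- A dyadic cube of side length `2^k`, `1 ≤ k ≤ j`, in the tiling of
`[2^j, 2^{j+1}) × ℝ^d`. -/
structure DyCube (d j : ℕ) where
  k : ℕ
  m : ℤ
  zv : Fin d → ℤ
  hk : 1 ≤ k ∧ k ≤ j
  hm : (2:ℤ) ^ (j - k) ≤ m ∧ m < 2 ^ (j + 1 - k)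

/-- side length of a dyadic cube -/
def DyCube.len {d j : ℕ} (Q : DyCube d j) : ℝ := 2 ^ Q.k

/-- a dyadic cube as a subset of `ℝ^{1+d}` -/
def DyCube.toSet {d j : ℕ} (Q : DyCube d j) : Set (ℝ × (Fin d → ℝ)) :=
  {p | ((Q.m : ℝ) * 2 ^ Q.k ≤ p.1 ∧ p.1 < (Q.m + 1) * 2 ^ Q.k) ∧
    ∀ i, (Q.zv i : ℝ) * 2 ^ Q.k ≤ p.2 i ∧ p.2 i < (Q.zv i + 1) * 2 ^ Q.k}

/-- center of a dyadic cube: the `r`-coordinate -/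
def DyCube.centerT {d j : ℕ} (Q : DyCube d j) : ℝ := ((Q.m : ℝ) + 1/2) * 2 ^ Q.k

/-- center of a dyadic cube: the `y`-coordinate -/
def DyCube.centerX {d j : ℕ} (Q : DyCube d j) : Rd d :=
  WithLp.toLp 2 fun i => ((Q.zv i : ℝ) + 1/2) * 2 ^ Q.k

/-- a point `(n,z) ∈ ℕ × ℤ^d` viewed as a point of `ℝ^{1+d}` -/
def embedPt (d : ℕ) (e : ℕ × (Fin d → ℤ)) : ℝ × (Fin d → ℝ) :=
  ((e.1 : ℝ), fun i => (e.2 i : ℝ))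

/-- the number of points of `E` lying in the cube `Q` -/
def cubeCount {d j : ℕ} (E : Finset (ℝ × (Fin d → ℝ))) (Q : DyCube d j) : ℕ :=
  (E.filter (· ∈ Q.toSet)).card

/-- `Q` is `λ`-dense: `#(E ∩ Q) > λ^p l(Q)` -/
def IsDense {d j : ℕ} (E : Finset (ℝ × (Fin d → ℝ))) (lam p : ℝ) (Q : DyCube d j) : Prop :=
  lam ^ p * Q.len < (cubeCount E Q : ℝ)

/-- `Q` is a maximal `λ`-dense dyadic cube -/
def IsMaxDense {d j : ℕ} (E : Finset (ℝ × (Fin d → ℝ))) (lam p : ℝ) (Q : DyCube d j) : Prop :=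
  IsDense E lam p Q ∧
    ∀ Q' : DyCube d j, IsDense E lam p Q' → Q.toSet ⊆ Q'.toSet → Q'.toSet = Q.toSet

/-- a lattice vector viewed as an element of `ℝ^d` -/
def latticeVec (d : ℕ) (z : Fin d → ℤ) : Rd d := WithLp.toLp 2 fun i => (z i : ℝ)

/-- The structural properties of the phase function `ψ = -ψ₋`: Lipschitz with constant `L`,
comparable to the norm, and homogeneous of degree one. -/
structure IsPsi {d : ℕ} (ψ : Rd d → ℝ) (L c₁ c₂ : ℝ) : Prop where
  lip : LipschitzWith (Real.toNNReal L) ψ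
  lower : ∀ x : Rd d, c₁ * ‖x‖ ≤ ψ x
  upper : ∀ x : Rd d, ψ x ≤ c₂ * ‖x‖
  homog : ∀ t : ℝ, 0 < t → ∀ x : Rd d, ψ (t • x) = t * ψ x

/-- The stationary phase kernel estimate for `K_r`, `r ≥ 2`:
`|K_r(x)| ≤ C_N (1+|x|+|r|)^{-(d-1)/2} (1+|ψ(x)-r|)^{-N}`. -/
def KernelEst {d : ℕ} (a : Rd d → ℝ) (η : ℝ → ℝ) (ψ : Rd d → ℝ) : Prop :=
  ∀ N : ℕ, ∃ C : ℝ, 0 < C ∧ ∀ r : ℝ, 2 ≤ r → ∀ x : Rd d,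
    ‖Kker a η r x‖ ≤ C * (1 + ‖x‖ + |r|) ^ (-(((d:ℝ) - 1) / 2)) * (1 + |ψ x - r|) ^ (-(N : ℝ))

/-- The two-sided stationary phase kernel estimate for `K_r`, `|r| ≥ 2`, with the
two phase functions `ψ₊`, `ψ₋`:
`|K_r(x)| ≤ C_N (1+|x|+|r|)^{-(d-1)/2} ∑_± (1+|ψ_±(x)+r|)^{-N}`. -/
def KernelEstPM {d : ℕ} (a : Rd d → ℝ) (η : ℝ → ℝ) (ψp ψm : Rd d → ℝ) : Prop :=
  ∀ N : ℕ, ∃ C : ℝ, 0 < C ∧ ∀ r : ℝ, 2 ≤ |r| → ∀ x : Rd d,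
    ‖Kker a η r x‖ ≤ C * (1 + ‖x‖ + |r|) ^ (-(((d:ℝ) - 1) / 2)) *
      ((1 + |ψp x + r|) ^ (-(N : ℝ)) + (1 + |ψm x + r|) ^ (-(N : ℝ)))

section OscillatoryIntegrals

open scoped ContDiff

variable {ι E : Type*} [NormedAddCommGroup E] [InnerProductSpace ℝ E]

/-- Derivative of `f` in the direction `w`. -/
def dirD (w : E) (f : E → ℝ) : E → ℝ := fun x => fderiv ℝ f x w

/-- The family `f` is bounded, uniformly in the index, together with its derivatives of order at
most `n` in the directions `w`. -/
def UB (w : ι → E) : ℕ → (ι → E → ℝ) → Prop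
  | 0, f => ∃ C, ∀ α x, |f α x| ≤ C
  | n + 1, f => (∃ C, ∀ α x, |f α x| ≤ C) ∧ UB w n (fun α => dirD (w α) (f α))

lemma ContDiff.dirD {w : E} {f : E → ℝ} (hf : ContDiff ℝ ∞ f) : ContDiff ℝ ∞ (dirD w f) :=
  (hf.fderiv_right (m := ∞) (by simp)).clm_apply contDiff_const

lemma dirD_mul {w : E} {f g : E → ℝ} (hf : ContDiff ℝ ∞ f) (hg : ContDiff ℝ ∞ g) :
    dirD w (fun x => f x * g x) = fun x => dirD w f x * g x + f x * dirD w g x := by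
  funext x
  have hf' := (hf.differentiable (by simp)) x
  have hg' := (hg.differentiable (by simp)) x
  simp only [dirD]
  rw [fderiv_fun_mul hf' hg']
  simp
  ring

lemma dirD_add {w : E} {f g : E → ℝ} (hf : ContDiff ℝ ∞ f) (hg : ContDiff ℝ ∞ g) :
    dirD w (fun x => f x + g x) = fun x => dirD w f x + dirD w g x := by
  funext x
  have hf' := (hf.differentiable (by simp)) x
  have hg' := (hg.differentiable (by simp)) x
  simp only [dirD]
  rw [fderiv_fun_add hf' hg']
  simp

lemma UB.bdd {w : ι → E} {n : ℕ} {f : ι → E → ℝ} (h : UB w n f) : ∃ C, ∀ α x, |f α x| ≤ C := by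
  cases n with
  | zero => exact h
  | succ n => exact h.1

lemma UB.of_succ {w : ι → E} {n : ℕ} {f : ι → E → ℝ} (h : UB w (n + 1) f) : UB w n f := by
  induction n generalizing f with
  | zero => exact h.1
  | succ n ih => exact ⟨h.1, ih h.2⟩

lemma UB.add {w : ι → E} {n : ℕ} {f g : ι → E → ℝ} (hfs : ∀ α, ContDiff ℝ ∞ (f α))
    (hgs : ∀ α, ContDiff ℝ ∞ (g α)) (hf : UB w n f) (hg : UB w n g) :
    UB w n (fun α x => f α x + g α x) := by
  have key : ∃ C, ∀ α x, |f α x + g α x| ≤ C := by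
    obtain ⟨C, hC⟩ := hf.bdd
    obtain ⟨D, hD⟩ := hg.bdd
    exact ⟨C + D, fun α x => (abs_add_le _ _).trans (add_le_add (hC α x) (hD α x))⟩
  induction n generalizing f g with
  | zero => exact key
  | succ n ih =>
    refine ⟨key, ?_⟩
    have := ih (fun α => (hfs α).dirD (w := w α)) (fun α => (hgs α).dirD (w := w α)) hf.2 hg.2
    simp only [fun α => dirD_add (w := w α) (hfs α) (hgs α)]
    apply this
    obtain ⟨C, hC⟩ := hf.2.bdd
    obtain ⟨D, hD⟩ := hg.2.bdd
    exact ⟨C + D, fun α x => (abs_add_le _ _).trans (add_le_add (hC α x) (hD α x))⟩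

lemma UB.mul {w : ι → E} {n : ℕ} {f g : ι → E → ℝ} (hfs : ∀ α, ContDiff ℝ ∞ (f α))
    (hgs : ∀ α, ContDiff ℝ ∞ (g α)) (hf : UB w n f) (hg : UB w n g) :
    UB w n (fun α x => f α x * g α x) := by
  have key : ∀ {f g : ι → E → ℝ}, (∃ C, ∀ α x, |f α x| ≤ C) → (∃ C, ∀ α x, |g α x| ≤ C) →
      ∃ C, ∀ α x, |f α x * g α x| ≤ C := by
    rintro f g ⟨C, hC⟩ ⟨D, hD⟩
    refine ⟨C * D, fun α x => ?_⟩
    rw [abs_mul]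
    exact mul_le_mul (hC α x) (hD α x) (abs_nonneg _) ((abs_nonneg _).trans (hC α x))
  induction n generalizing f g with
  | zero => exact key hf.bdd hg.bdd
  | succ n ih =>
    refine ⟨key hf.bdd hg.bdd, ?_⟩
    simp only [fun α => dirD_mul (w := w α) (hfs α) (hgs α)]
    exact UB.add (fun α => (hfs α).dirD.mul (hgs α)) (fun α => (hfs α).mul (hgs α).dirD)
      (ih (fun α => (hfs α).dirD) hgs hf.2 hg.of_succ)
      (ih hfs (fun α => (hgs α).dirD) hf.of_succ hg.2)

lemma UB.const_mul {w : ι → E} {n : ℕ} {f : ι → E → ℝ} (c : ℝ) (hfs : ∀ α, ContDiff ℝ ∞ (f α))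
    (hf : UB w n f) : UB w n (fun α x => c * f α x) := by
  have key : ∀ {f : ι → E → ℝ}, (∃ C, ∀ α x, |f α x| ≤ C) → ∃ C, ∀ α x, |c * f α x| ≤ C := by
    rintro f ⟨C, hC⟩
    refine ⟨|c| * C, fun α x => ?_⟩
    rw [abs_mul]
    exact mul_le_mul_of_nonneg_left (hC α x) (abs_nonneg _)
  induction n generalizing f with
  | zero => exact key hf.bdd
  | succ n ih =>
    refine ⟨key hf.bdd, ?_⟩
    have : (fun α => _root_.dirD (w α) (fun x => c * f α x)) =
        fun α x => c * _root_.dirD (w α) (f α) x := by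
      funext α x
      simp only [_root_.dirD]
      rw [fderiv_const_mul ((hfs α).differentiable (by simp) x)]
      simp
    rw [this]
    exact ih (fun α => (hfs α).dirD) hf.2

lemma UB.inv {w : ι → E} {c : ℝ} (hc : 0 < c) {f : ι → E → ℝ} (hfs : ∀ α, ContDiff ℝ ∞ (f α))
    (hfc : ∀ α x, c ≤ f α x) (hf : ∀ n, UB w n f) (n : ℕ) : UB w n (fun α x => (f α x)⁻¹) := by
  have hpos : ∀ α x, 0 < f α x := fun α x => hc.trans_le (hfc α x)
  have hsm : ∀ α, ContDiff ℝ ∞ (fun x => (f α x)⁻¹) :=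
    fun α => (hfs α).inv fun x => (hpos α x).ne'
  have hbd : ∃ C, ∀ α x, |(f α x)⁻¹| ≤ C := by
    refine ⟨c⁻¹, fun α x => ?_⟩
    rw [abs_of_pos (inv_pos.2 (hpos α x))]
    exact inv_anti₀ hc (hfc α x)
  induction n with
  | zero => exact hbd
  | succ n ih =>
    refine ⟨hbd, ?_⟩
    have : (fun α => dirD (w α) (fun x => (f α x)⁻¹)) =
        fun α x => -1 * (dirD (w α) (f α) x * ((f α x)⁻¹ * (f α x)⁻¹)) := by
      funext α x
      have h := (hasDerivAt_inv (hpos α x).ne').comp_hasFDerivAt x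
        (((hfs α).differentiable (by simp) x).hasFDerivAt)
      have h' : fderiv ℝ (fun x => (f α x)⁻¹) x = _ := h.fderiv
      simp only [dirD]
      rw [h']
      simp
      ring
    rw [this]
    exact UB.const_mul _ (fun α => (hfs α).dirD.mul ((hsm α).mul (hsm α)))
      (UB.mul (fun α => (hfs α).dirD) (fun α => (hsm α).mul (hsm α)) (hf (n + 1)).2
        (UB.mul hsm hsm ih ih))

lemma UB.of_iteratedFDeriv {w : ι → E} (hw : ∀ α, ‖w α‖ ≤ 1) {f : ι → E → ℝ}
    (hfs : ∀ α, ContDiff ℝ ∞ (f α))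
    (hf : ∀ k, ∃ C, ∀ α x, ‖iteratedFDeriv ℝ k (f α) x‖ ≤ C) (n : ℕ) : UB w n f := by
  induction n generalizing f with
  | zero =>
    obtain ⟨C, hC⟩ := hf 0
    exact ⟨C, fun α x => by simpa using hC α x⟩
  | succ n ih =>
    refine ⟨?_, ih (fun α => (hfs α).dirD) fun k => ?_⟩
    · obtain ⟨C, hC⟩ := hf 0
      exact ⟨C, fun α x => by simpa using hC α x⟩
    · obtain ⟨C, hC⟩ := hf (k + 1)
      refine ⟨C, fun α x => ?_⟩
      have h1 : _root_.dirD (w α) (f α) =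
          (ContinuousLinearMap.apply ℝ ℝ (w α)) ∘ (fderiv ℝ (f α)) := rfl
      have h2 : ContDiff ℝ ∞ (fderiv ℝ (f α)) := (hfs α).fderiv_right (by simp)
      rw [h1]
      calc _ ≤ ‖ContinuousLinearMap.apply ℝ ℝ (w α)‖ * ‖iteratedFDeriv ℝ k (fderiv ℝ (f α)) x‖ :=
            ContinuousLinearMap.norm_iteratedFDeriv_comp_left _ h2.contDiffAt
              (by exact_mod_cast le_top)
        _ ≤ 1 * ‖iteratedFDeriv ℝ (k + 1) (f α) x‖ := by
            rw [norm_iteratedFDeriv_fderiv]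
            gcongr
            refine ContinuousLinearMap.opNorm_le_bound _ zero_le_one fun L => ?_
            simp only [ContinuousLinearMap.apply_apply]
            calc _ ≤ ‖L‖ * ‖w α‖ := L.le_opNorm _
              _ ≤ ‖L‖ * 1 := by gcongr; exact hw α
              _ = _ := by ring
        _ ≤ C := by rw [one_mul]; exact hC α x

lemma contDiff_oscExp {φ : E → ℝ} (hφ : ContDiff ℝ ∞ φ) (lam : ℝ) :
    ContDiff ℝ ∞ fun x => Complex.exp (((lam * φ x : ℝ) : ℂ) * Complex.I) :=
  ((Complex.ofRealCLM.contDiff.comp (contDiff_const.mul hφ)).mul contDiff_const).cexp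

variable [FiniteDimensional ℝ E] [MeasurableSpace E] [BorelSpace E]

/-- Integration by parts against an oscillating exponential. -/
lemma osc_ibp {g v φ : E → ℝ} {w : E} {S : Set E} (hS : IsCompact S) (hg : ContDiff ℝ ∞ g)
    (hv : ContDiff ℝ ∞ v) (hφ : ContDiff ℝ ∞ φ) (hgS : ∀ x ∉ S, g x = 0)
    (hvφ : ∀ x ∈ S, v x * dirD w φ x = 1) {lam : ℝ} (hl : 0 < lam) :
    ‖∫ x, (g x : ℂ) * Complex.exp (((lam * φ x : ℝ) : ℂ) * Complex.I)‖ =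
      lam⁻¹ * ‖∫ x, ((dirD w (fun x => g x * v x) x : ℝ) : ℂ) *
        Complex.exp (((lam * φ x : ℝ) : ℂ) * Complex.I)‖ := by
  set e : E → ℂ := fun x => Complex.exp (((lam * φ x : ℝ) : ℂ) * Complex.I) with he
  have hes : ContDiff ℝ ∞ e := contDiff_oscExp hφ lam
  set q : E → ℝ := fun x => g x * v x with hq
  have hqs : ContDiff ℝ ∞ q := hg.mul hv
  have hqS : ∀ x ∉ S, q x = 0 := fun x hx => by simp [hq, hgS x hx]
  have hqc : HasCompactSupport q := HasCompactSupport.intro hS hqS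
  have hde : ∀ x, fderiv ℝ e x w = (lam * Complex.I) * ((dirD w φ x : ℂ) * e x) := by
    intro x
    have h1 : HasFDerivAt φ (fderiv ℝ φ x) x := (hφ.differentiable (by simp) x).hasFDerivAt
    have h2 := ((Complex.ofRealCLM.hasFDerivAt.comp x (h1.const_mul lam)).mul_const
      Complex.I).cexp
    have h3 : HasFDerivAt e _ x := h2
    rw [h3.fderiv]
    simp [dirD, he]
    ring
  have hcd : Continuous fun x => fderiv ℝ e x w :=
    ((hes.fderiv_right (m := ∞) (by simp)).clm_apply contDiff_const).continuous
  have hcq : Continuous fun x => fderiv ℝ q x w :=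
    ((hqs.fderiv_right (m := ∞) (by simp)).clm_apply contDiff_const).continuous
  have hqc' : HasCompactSupport fun x => fderiv ℝ q x w := hqc.fderiv_apply (𝕜 := ℝ) w
  have key := integral_smul_fderiv_eq_neg_fderiv_smul_of_integrable (μ := (volume : Measure E))
    (f := q) (g := e) (v := w)
    ((hcq.smul hes.continuous).integrable_of_hasCompactSupport hqc'.smul_right)
    ((hqs.continuous.smul hcd).integrable_of_hasCompactSupport hqc.smul_right)
    ((hqs.continuous.smul hes.continuous).integrable_of_hasCompactSupport hqc.smul_right)
    (fun x _ => hqs.differentiable (by simp) x) (fun x _ => hes.differentiable (by simp) x)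
  have h1 : ∫ x, q x • fderiv ℝ e x w = (lam * Complex.I) * ∫ x, (g x : ℂ) * e x := by
    rw [← integral_const_mul]
    congr 1
    funext x
    rw [hde, Complex.real_smul]
    by_cases hx : x ∈ S
    · have := hvφ x hx
      have h' : (v x : ℂ) * (dirD w φ x : ℂ) = 1 := by exact_mod_cast this
      simp only [hq, Complex.ofReal_mul]
      linear_combination (g x * lam * Complex.I * e x) * h'
    · simp [hq, hgS x hx]
  have h2 : ∫ x, fderiv ℝ q x w • e x = ∫ x, ((dirD w q x : ℝ) : ℂ) * e x := by
    simp only [Complex.real_smul, dirD]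
  rw [h1, h2] at key
  have h3 := congrArg norm key
  rw [norm_mul, norm_neg, norm_mul, Complex.norm_I, Complex.norm_real, Real.norm_eq_abs,
    abs_of_pos hl, mul_one] at h3
  rw [← h3, inv_mul_cancel_left₀ hl.ne']

/-- Nonstationary phase, uniformly for families of phases and amplitudes. -/
theorem nonstationary_phase {w : ι → E} {S : ι → Set E} {K : Set E} (hK : IsCompact K)
    (hS : ∀ α, IsClosed (S α)) (hSK : ∀ α, S α ⊆ K) {v φ : ι → E → ℝ}
    (hvs : ∀ α, ContDiff ℝ ∞ (v α)) (hφs : ∀ α, ContDiff ℝ ∞ (φ α)) (hv : ∀ n, UB w n v)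
    (hvφ : ∀ α, ∀ x ∈ S α, v α x * dirD (w α) (φ α) x = 1) (N : ℕ) (g : ι → E → ℝ)
    (hgs : ∀ α, ContDiff ℝ ∞ (g α)) (hg : ∀ n, UB w n g) (hgS : ∀ α, ∀ x ∉ S α, g α x = 0) :
    ∃ C, 0 ≤ C ∧ ∀ α, ∀ lam : ℝ, 0 < lam →
      ‖∫ x, (g α x : ℂ) * Complex.exp (((lam * φ α x : ℝ) : ℂ) * Complex.I)‖ ≤
        C * (lam ^ N)⁻¹ := by
  induction N generalizing g with
  | zero =>
    obtain ⟨C, hC⟩ := (hg 0).bdd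
    refine ⟨|C| * (volume K).toReal, by positivity, fun α lam _ => ?_⟩
    have : ∫ x, (g α x : ℂ) * Complex.exp (((lam * φ α x : ℝ) : ℂ) * Complex.I) =
        ∫ x in K, (g α x : ℂ) * Complex.exp (((lam * φ α x : ℝ) : ℂ) * Complex.I) := by
      refine (setIntegral_eq_integral_of_forall_compl_eq_zero fun x hx => ?_).symm
      rw [hgS α x fun h => hx (hSK α h)]
      simp
    rw [this, pow_zero, inv_one, mul_one]
    refine norm_setIntegral_le_of_norm_le_const hK.measure_lt_top fun x _ => ?_
    rw [norm_mul, Complex.norm_exp_ofReal_mul_I, mul_one, Complex.norm_real]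
    exact (hC α x).trans (le_abs_self C)
  | succ N ih =>
    obtain ⟨C, hC0, hC⟩ := ih (fun α => dirD (w α) (fun x => g α x * v α x))
      (fun α => ((hgs α).mul (hvs α)).dirD)
      (fun n => (UB.mul hgs hvs (hg (n + 1)) (hv (n + 1))).2) (by
        intro α x hx
        have : (fun x => g α x * v α x) =ᶠ[nhds x] fun _ => 0 := by
          filter_upwards [(hS α).isOpen_compl.mem_nhds hx] with y hy
          simp [hgS α y hy]
        simp [dirD, this.fderiv_eq])
    refine ⟨C, hC0, fun α lam hl => ?_⟩
    rw [osc_ibp (hK.of_isClosed_subset (hS α) (hSK α)) (hgs α) (hvs α) (hφs α) (hgS α) (hvφ α) hl]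
    calc _ ≤ lam⁻¹ * (C * (lam ^ N)⁻¹) := by
          gcongr
          exact hC α lam hl
      _ = _ := by rw [pow_succ]; field_simp

end OscillatoryIntegrals

section DifferencedPhase

open scoped ContDiff

variable {ι E V : Type*} [NormedAddCommGroup E] [InnerProductSpace ℝ E]
  [NormedAddCommGroup V] [InnerProductSpace ℝ V]

/-- All derivatives of `f` are bounded. -/
def BddDerivs (f : E → ℝ) : Prop := ∀ k, ∃ C, ∀ x, ‖iteratedFDeriv ℝ k f x‖ ≤ C

lemma BddDerivs.of_hasCompactSupport {f : E → ℝ} (hf : ContDiff ℝ ∞ f)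
    (hc : HasCompactSupport f) : BddDerivs f := fun k =>
  (hc.iteratedFDeriv (𝕜 := ℝ) k).exists_bound_of_continuous
    (hf.continuous_iteratedFDeriv (by exact_mod_cast le_top))

lemma iteratedFDeriv_diff_bound {f : E → ℝ} (hf : ContDiff ℝ ∞ f) (hb : BddDerivs f)
    (h : ι → E) (hh : ∀ α, h α ≠ 0) (k : ℕ) :
    ∃ C, ∀ α x, ‖iteratedFDeriv ℝ k (fun x => ‖h α‖⁻¹ * (f (x + h α) - f x)) x‖ ≤ C := by
  obtain ⟨C, hC⟩ := hb (k + 1)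
  refine ⟨C, fun α x => ?_⟩
  have hk : ∀ {g : E → ℝ} {x : E}, ContDiff ℝ ∞ g → ContDiffAt ℝ (k : ℕ) g x :=
    fun hg => (hg.of_le (by exact_mod_cast le_top)).contDiffAt
  have h1 : (fun x => ‖h α‖⁻¹ * (f (x + h α) - f x)) =
      ‖h α‖⁻¹ • ((fun x => f (x + h α)) - f) := by
    funext x; simp
  have hs : ContDiff ℝ ∞ (fun x => f (x + h α)) := hf.comp (contDiff_id.add contDiff_const)
  rw [h1, iteratedFDeriv_const_smul_apply (f := (fun x => f (x + h α)) - f) (hk (hs.sub hf)),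
    iteratedFDeriv_sub_apply (hk hs) (hk hf), iteratedFDeriv_comp_add_right, norm_smul, norm_inv,
    norm_norm]
  have hd : Differentiable ℝ (iteratedFDeriv ℝ k f) :=
    hf.differentiable_iteratedFDeriv (by exact_mod_cast WithTop.coe_lt_top _)
  have := convex_univ.norm_image_sub_le_of_norm_fderiv_le (𝕜 := ℝ) (f := iteratedFDeriv ℝ k f)
    (C := C) (fun x _ => hd x) (fun x _ => by rw [norm_fderiv_iteratedFDeriv]; exact hC x)
    (mem_univ x) (mem_univ (x + h α))
  rw [add_sub_cancel_left] at this
  have hpos : 0 < ‖h α‖ := norm_pos_iff.2 (hh α)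
  rw [inv_mul_le_iff₀ hpos]
  linarith

lemma iteratedFDeriv_translate_bound {f : E → ℝ} (hb : BddDerivs f) (h : ι → E) (k : ℕ) :
    ∃ C, ∀ α x, ‖iteratedFDeriv ℝ k (fun x => f (x + h α)) x‖ ≤ C := by
  obtain ⟨C, hC⟩ := hb k
  exact ⟨C, fun α x => by rw [iteratedFDeriv_comp_add_right]; exact hC _⟩

/-- If the Hessian of `f` at `ξ₀` is nondegenerate on the range of `J`, then the gradient of `f`
moves at unit speed along this range, near `ξ₀`. -/
lemma exists_direction_of_hessian [FiniteDimensional ℝ V] {f : E → ℝ} (hf : ContDiff ℝ ∞ f)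
    (J : V →ₗᵢ[ℝ] E) (ξ₀ : E)
    (hH : ∀ v : V, v ≠ 0 → fderiv ℝ (fderiv ℝ f) ξ₀ (J v) ≠ 0) :
    ∃ c > 0, ∃ ε > 0, ∀ v : V, v ≠ 0 → ∃ w : E, ‖w‖ ≤ 1 ∧
      ∀ ξ ∈ Metric.ball ξ₀ (2 * ε), ξ + J v ∈ Metric.ball ξ₀ (2 * ε) →
        c * ‖v‖ ≤ dirD w f (ξ + J v) - dirD w f ξ := by
  set H := fderiv ℝ (fderiv ℝ f) ξ₀ with hHdef
  have hf1 : ContDiff ℝ ∞ (fderiv ℝ f) := hf.fderiv_right (by simp)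
  have hf2 : Continuous (fderiv ℝ (fderiv ℝ f)) :=
    (hf1.fderiv_right (m := ∞) (by simp)).continuous
  obtain ⟨K, hK, hanti⟩ := LinearMap.exists_antilipschitzWith
    ((H : E →ₗ[ℝ] (E →L[ℝ] ℝ)).comp J.toLinearMap) (by
      rw [LinearMap.ker_eq_bot']
      intro v hv
      by_contra hne
      exact hH v hne hv)
  have hKpos : (0 : ℝ) < K := hK
  have hlow : ∀ v : V, ‖v‖ ≤ K * ‖H (J v)‖ := fun v => by
    have := hanti.le_mul_dist v 0
    simpa [dist_eq_norm] using this
  obtain ⟨δ, hδ, hδ'⟩ := (Metric.continuous_iff (β := E →L[ℝ] E →L[ℝ] ℝ)).1 hf2 ξ₀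
    (1 / (4 * K)) (by positivity)
  refine ⟨1 / (4 * K), by positivity, δ / 2, by positivity, fun v hv => ?_⟩
  have hvpos : 0 < ‖v‖ := norm_pos_iff.2 hv
  have hHpos : ‖v‖ / K ≤ ‖H (J v)‖ := by rw [div_le_iff₀ hKpos, mul_comm]; exact hlow v
  have : ∃ w : E, ‖w‖ ≤ 1 ∧ ‖v‖ / (2 * K) ≤ H (J v) w := by
    have h2 : ‖v‖ / (2 * K) < ‖H (J v)‖ := by
      refine lt_of_lt_of_le ?_ hHpos
      gcongr
      linarith
    obtain ⟨w, hw, hw'⟩ := (H (J v)).exists_lt_apply_of_lt_opNorm h2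
    rw [Real.norm_eq_abs] at hw'
    rcases le_or_gt 0 (H (J v) w) with h0 | h0
    · exact ⟨w, hw.le, by rw [abs_of_nonneg h0] at hw'; exact hw'.le⟩
    · refine ⟨-w, by simpa using hw.le, ?_⟩
      rw [abs_of_neg h0] at hw'
      simpa using hw'.le
  obtain ⟨w, hw1, hw2⟩ := this
  refine ⟨w, hw1, fun ξ hξ hξ' => ?_⟩
  rw [mul_div_cancel₀ _ (two_ne_zero)] at hξ hξ'
  have hmv := (convex_ball ξ₀ δ).norm_image_sub_le_of_norm_fderiv_le' (𝕜 := ℝ) (f := fderiv ℝ f)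
    (C := 1 / (4 * K)) (φ := H) (fun x _ => hf1.differentiable (by simp) x)
    (fun x hx => by
      have := hδ' x hx
      exact ((dist_eq_norm (fderiv ℝ (fderiv ℝ f) x) H).symm.trans_lt this).le) hξ hξ'
  rw [add_sub_cancel_left, J.norm_map] at hmv
  have h3 : |(fderiv ℝ f (ξ + J v) - fderiv ℝ f ξ - H (J v)) w| ≤ 1 / (4 * K) * ‖v‖ := by
    calc _ ≤ ‖fderiv ℝ f (ξ + J v) - fderiv ℝ f ξ - H (J v)‖ * ‖w‖ :=
          ContinuousLinearMap.le_opNorm _ _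
      _ ≤ (1 / (4 * K) * ‖v‖) * 1 := by gcongr
      _ = _ := mul_one _
  have h4 := (abs_le.1 h3).1
  simp only [sub_apply] at h4
  simp only [dirD]
  have h5 : ‖v‖ / (2 * K) = 2 * (1 / (4 * K) * ‖v‖) := by field_simp; norm_num
  linarith

variable [FiniteDimensional ℝ E] [MeasurableSpace E] [BorelSpace E]

/-- Decay of the oscillatory integral with a differenced phase. -/
lemma differenced_decay {f : E → ℝ} (hf : ContDiff ℝ ∞ f) (hb : BddDerivs f) (J : V →ₗᵢ[ℝ] E)
    (ξ₀ : E) {c ε : ℝ} (hc : 0 < c) (hε : 0 < ε)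
    (hw : ∀ v : V, v ≠ 0 → ∃ w : E, ‖w‖ ≤ 1 ∧
      ∀ ξ ∈ Metric.ball ξ₀ (2 * ε), ξ + J v ∈ Metric.ball ξ₀ (2 * ε) →
        c * ‖v‖ ≤ dirD w f (ξ + J v) - dirD w f ξ)
    {χ : E → ℝ} (hχ : ContDiff ℝ ∞ χ) (hχ0 : ∀ ξ ∉ Metric.closedBall ξ₀ ε, χ ξ = 0) (N : ℕ) :
    ∃ C, 0 ≤ C ∧ ∀ v : V, v ≠ 0 → ∀ lam : ℝ, 0 < lam →
      ‖∫ ξ, ((χ (ξ + J v) * χ ξ : ℝ) : ℂ) *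
        Complex.exp (((lam * (‖J v‖⁻¹ * (f (ξ + J v) - f ξ)) : ℝ) : ℂ) * Complex.I)‖ ≤
        C * (lam ^ N)⁻¹ := by
  choose! w hw1 hw2 using hw
  let A := {v : V // v ≠ 0}
  let h : A → E := fun α => J α.1
  have hh : ∀ α : A, h α ≠ 0 := fun α h0 => α.2 (J.injective (h0.trans J.map_zero.symm))
  let W : A → E := fun α => w α.1
  have hW : ∀ α, ‖W α‖ ≤ 1 := fun α => hw1 _ α.2
  let φ : A → E → ℝ := fun α ξ => ‖h α‖⁻¹ * (f (ξ + h α) - f ξ)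
  have hshift : ∀ {g : E → ℝ}, ContDiff ℝ ∞ g → ∀ α : A, ContDiff ℝ ∞ fun ξ => g (ξ + h α) :=
    fun hg α => hg.comp (contDiff_id.add contDiff_const)
  have hφs : ∀ α, ContDiff ℝ ∞ (φ α) := fun α =>
    contDiff_const.mul ((hshift hf α).sub hf)
  have hφU : ∀ n, UB W n φ := UB.of_iteratedFDeriv hW hφs (iteratedFDeriv_diff_bound hf hb h hh)
  let u : A → E → ℝ := fun α => dirD (W α) (φ α)
  have hus : ∀ α, ContDiff ℝ ∞ (u α) := fun α => (hφs α).dirD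
  have huU : ∀ n, UB W n u := fun n => (hφU (n + 1)).2
  let β : ContDiffBump ξ₀ := ⟨ε, 2 * ε, hε, by linarith⟩
  have hβs : ContDiff ℝ ∞ (β : E → ℝ) := β.contDiff
  have hβb : BddDerivs (β : E → ℝ) := .of_hasCompactSupport hβs β.hasCompactSupport
  have prodU : ∀ {g : E → ℝ}, ContDiff ℝ ∞ g → BddDerivs g → ∀ n,
      UB W n (fun (α : A) ξ => g (ξ + h α) * g ξ) := fun {g} hg hgb n =>
    UB.mul (f := fun (α : A) ξ => g (ξ + h α)) (g := fun _ => g) (hshift hg) (fun _ => hg)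
      (UB.of_iteratedFDeriv hW (hshift hg) (iteratedFDeriv_translate_bound hgb h) n)
      (UB.of_iteratedFDeriv hW (fun _ => hg) (fun k => by
        obtain ⟨C, hC⟩ := hgb k
        exact ⟨C, fun _ => hC⟩) n)
  let θ : A → E → ℝ := fun α ξ => β (ξ + h α) * β ξ
  have hθs : ∀ α, ContDiff ℝ ∞ (θ α) := fun α => (hshift hβs α).mul hβs
  have hθU : ∀ n, UB W n θ := prodU hβs hβb
  have hulow : ∀ α ξ, ξ ∈ Metric.ball ξ₀ (2 * ε) → ξ + h α ∈ Metric.ball ξ₀ (2 * ε) →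
      c ≤ u α ξ := by
    intro α ξ h1 h2
    have h3 := hw2 α.1 α.2 ξ h1 h2
    have hpos : 0 < ‖α.1‖ := norm_pos_iff.2 α.2
    have hd : u α ξ = ‖h α‖⁻¹ * (dirD (W α) f (ξ + h α) - dirD (W α) f ξ) := by
      have d1 : HasFDerivAt (fun ξ => f (ξ + h α)) (fderiv ℝ f (ξ + h α)) ξ :=
        (hasFDerivAt_comp_add_right (h α)).2 (hf.differentiable (by simp) _).hasFDerivAt
      have d2 := (d1.sub (hf.differentiable (by simp) ξ).hasFDerivAt).const_mul ‖h α‖⁻¹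
      have d3 : fderiv ℝ (φ α) ξ = _ := d2.fderiv
      simp only [u, dirD]
      rw [d3]
      simp
    rw [hd, show ‖h α‖ = ‖α.1‖ from J.norm_map _, le_inv_mul_iff₀ hpos, mul_comm]
    exact h3
  -- a globally invertible modification of `u`
  let U : A → E → ℝ := fun α ξ => θ α ξ * (u α ξ + -c) + c
  have hUs : ∀ α, ContDiff ℝ ∞ (U α) := fun α =>
    ((hθs α).mul ((hus α).add contDiff_const)).add contDiff_const
  have constU : ∀ (k : ℝ) n, UB W n (fun (_ : A) (_ : E) => k) := fun k =>
    UB.of_iteratedFDeriv hW (fun _ => contDiff_const) (fun m => by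
      rcases m with _ | m
      · exact ⟨|k|, fun _ x => by simp⟩
      · exact ⟨0, fun _ x => by simp [iteratedFDeriv_const_of_ne]⟩)
  have hUU : ∀ n, UB W n U := fun n =>
    UB.add (fun α => (hθs α).mul ((hus α).add contDiff_const)) (fun _ => contDiff_const)
      (UB.mul hθs (fun α => (hus α).add contDiff_const) (hθU n)
        (UB.add hus (fun _ => contDiff_const) (huU n) (constU (-c) n))) (constU c n)
  have hUlow : ∀ α ξ, c ≤ U α ξ := by
    intro α ξ
    have : 0 ≤ θ α ξ * (u α ξ + -c) := by
      by_cases h1 : ξ ∈ Metric.ball ξ₀ (2 * ε)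
      · by_cases h2 : ξ + h α ∈ Metric.ball ξ₀ (2 * ε)
        · exact mul_nonneg (mul_nonneg β.nonneg β.nonneg) (by linarith [hulow α ξ h1 h2])
        · have : β (ξ + h α) = 0 := β.zero_of_le_dist (not_lt.1 h2)
          simp [θ, this]
      · have : β ξ = 0 := β.zero_of_le_dist (not_lt.1 h1)
        simp [θ, this]
    simp only [U]
    linarith
  let S : A → Set E := fun α =>
    Metric.closedBall ξ₀ ε ∩ (fun ξ => ξ + h α) ⁻¹' Metric.closedBall ξ₀ ε
  obtain ⟨C, hC0, hC⟩ := nonstationary_phase (w := W) (S := S)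
    (isCompact_closedBall ξ₀ ε)
    (fun α => Metric.isClosed_closedBall.inter
      (Metric.isClosed_closedBall.preimage (by fun_prop)))
    (fun α => inter_subset_left) (v := fun α ξ => (U α ξ)⁻¹) (φ := φ)
    (fun α => (hUs α).inv fun ξ => (hc.trans_le (hUlow α ξ)).ne') hφs
    (UB.inv hc hUs hUlow hUU) (by
      intro α ξ hξ
      have h1 : U α ξ = u α ξ := by
        have e1 : β ξ = 1 := β.one_of_mem_closedBall hξ.1
        have e2 : β (ξ + h α) = 1 := β.one_of_mem_closedBall hξ.2
        simp [U, θ, e1, e2]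
      have h2 : 0 < U α ξ := hc.trans_le (hUlow α ξ)
      rw [show dirD (W α) (φ α) ξ = u α ξ from rfl, ← h1]
      exact inv_mul_cancel₀ h2.ne') N
    (fun α ξ => χ (ξ + h α) * χ ξ) (fun α => (hshift hχ α).mul hχ)
    (prodU hχ (.of_hasCompactSupport hχ
      (HasCompactSupport.intro (isCompact_closedBall ξ₀ ε) hχ0))) (by
      intro α ξ hξ
      by_cases h1 : ξ ∈ Metric.closedBall ξ₀ ε
      · have : ξ + h α ∉ Metric.closedBall ξ₀ ε := fun h2 => hξ ⟨h1, h2⟩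
        simp [hχ0 _ this]
      · simp [hχ0 _ h1])
  exact ⟨C, hC0, fun v hv lam hl => hC ⟨v, hv⟩ lam hl⟩

end DifferencedPhase

section Differencing

variable {E V : Type*} [NormedAddCommGroup E] [InnerProductSpace ℝ E] [FiniteDimensional ℝ E]
  [MeasurableSpace E] [BorelSpace E]
  [NormedAddCommGroup V] [InnerProductSpace ℝ V]

/-- The autocorrelation of `F` along the range of `J`. -/
def autocorr (J : V →ₗᵢ[ℝ] E) (F : E → ℂ) (v : V) : ℂ :=
  ∫ ξ, F (ξ + J v) * (starRingEnd ℂ) (F ξ)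

lemma autocorr_eq_zero {J : V →ₗᵢ[ℝ] E} {F : E → ℂ} {ξ₀ : E} {ε : ℝ}
    (hF0 : ∀ ξ ∉ Metric.closedBall ξ₀ ε, F ξ = 0) {v : V} (hv : 2 * ε < ‖v‖) :
    autocorr J F v = 0 := by
  rw [autocorr, ← integral_zero E ℂ]
  congr 1
  funext ξ
  by_cases h1 : ξ ∈ Metric.closedBall ξ₀ ε
  · have : ξ + J v ∉ Metric.closedBall ξ₀ ε := by
      intro h2
      rw [mem_closedBall_iff_norm] at h1 h2
      have h3 : J v = (ξ + J v - ξ₀) - (ξ - ξ₀) := by abel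
      have h4 := norm_sub_le (ξ + J v - ξ₀) (ξ - ξ₀)
      rw [← h3, J.norm_map] at h4
      linarith
    simp [hF0 _ this]
  · simp [hF0 _ h1]

lemma autocorr_continuous {J : V →ₗᵢ[ℝ] E} {F : E → ℂ} {ξ₀ : E} {ε : ℝ} (hF : Continuous F)
    (hF0 : ∀ ξ ∉ Metric.closedBall ξ₀ ε, F ξ = 0) : Continuous (autocorr J F) := by
  have hFc : HasCompactSupport F := HasCompactSupport.intro (isCompact_closedBall ξ₀ ε) hF0
  obtain ⟨C, hC⟩ := hFc.exists_bound_of_continuous hF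
  refine continuous_of_dominated (bound := fun ξ => C * ‖F ξ‖) (fun v => ?_) (fun v => ?_) ?_ ?_
  · exact Continuous.aestronglyMeasurable (by fun_prop)
  · refine Filter.Eventually.of_forall fun ξ => ?_
    rw [norm_mul, RCLike.norm_conj]
    gcongr
    exact hC _
  · exact (hF.norm.integrable_of_hasCompactSupport hFc.norm).const_mul C
  · exact Filter.Eventually.of_forall fun ξ => by
      have : Continuous fun v => J v := J.continuous
      fun_prop

variable [FiniteDimensional ℝ V] [MeasurableSpace V] [BorelSpace V]

lemma autocorr_integrable {J : V →ₗᵢ[ℝ] E} {F : E → ℂ} {ξ₀ : E} {ε : ℝ} (hF : Continuous F)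
    (hF0 : ∀ ξ ∉ Metric.closedBall ξ₀ ε, F ξ = 0) : Integrable (autocorr J F) := by
  refine (autocorr_continuous hF hF0).integrable_of_hasCompactSupport
    (HasCompactSupport.intro (isCompact_closedBall (0 : V) (2 * ε)) fun v hv => ?_)
  exact autocorr_eq_zero hF0 (by simpa using hv)

/-- An integral is controlled by the autocorrelation of its integrand. -/
theorem norm_integral_le_autocorr (J : V →ₗᵢ[ℝ] E) (ξ₀ : E) (ε : ℝ) :
    ∃ C, 0 ≤ C ∧ ∀ F : E → ℂ, Continuous F → (∀ ξ ∉ Metric.closedBall ξ₀ ε, F ξ = 0) →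
      ∀ t : ℝ, 0 < t → ‖∫ ξ, F ξ‖ ≤ C * (t + t⁻¹ * ∫ v, ‖autocorr J F v‖) := by
  let ψ : ContDiffBump (0 : V) := ⟨1, 2, one_pos, one_lt_two⟩
  have hψc : Continuous (ψ : V → ℝ) := ψ.continuous
  have hψi : Integrable (ψ : V → ℝ) := ψ.integrable
  set c : ℝ := ∫ v, ψ v with hc
  have hcpos : 0 < c := ψ.integral_pos
  set s : ℝ := (volume (Metric.closedBall ξ₀ (ε + 2))).toReal with hs
  refine ⟨c⁻¹ * (s + c), by positivity, fun F hF hF0 t ht => ?_⟩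
  have hJc : Continuous fun v => J v := J.continuous
  let P : E → ℂ := fun ξ => ∫ v, (ψ v : ℂ) * F (ξ + J v)
  have hsupp : ∀ v ξ, (ψ v : ℂ) * F (ξ + J v) ≠ 0 →
      v ∈ Metric.closedBall (0 : V) 2 ∧ ξ ∈ Metric.closedBall ξ₀ (ε + 2) := by
    intro v ξ h
    have h1 : v ∈ Metric.closedBall (0 : V) 2 := by
      by_contra h1
      have : ψ v = 0 := ψ.zero_of_le_dist (not_le.1 h1).le
      simp [this] at h
    refine ⟨h1, ?_⟩
    by_contra h2
    apply h
    rw [hF0 (ξ + J v), mul_zero]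
    intro h3
    apply h2
    rw [mem_closedBall_iff_norm] at h3 ⊢
    have h4 : ‖J v‖ ≤ 2 := by rw [J.norm_map]; simpa using h1
    have h5 : ξ - ξ₀ = (ξ + J v - ξ₀) - J v := by abel
    rw [h5]
    exact (norm_sub_le _ _).trans (by linarith)
  have hkc : IsCompact (Metric.closedBall (0 : V) 2) := isCompact_closedBall _ _
  have hKc : IsCompact (Metric.closedBall ξ₀ (ε + 2)) := isCompact_closedBall _ _
  -- averaging over translations
  have hswap : ∫ ξ, P ξ = (c : ℂ) * ∫ ξ, F ξ := by
    have h1 := integral_integral_swap_of_hasCompactSupport (μ := (volume : Measure E))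
      (ν := (volume : Measure V)) (f := fun ξ v => (ψ v : ℂ) * F (ξ + J v))
      (by simp only [Function.uncurry_def]; fun_prop)
      (HasCompactSupport.intro (hKc.prod hkc) (by
        rintro ⟨ξ, v⟩ hn
        by_contra h
        exact hn ⟨(hsupp v ξ h).2, (hsupp v ξ h).1⟩))
    rw [show ∫ ξ, P ξ = _ from h1]
    have : ∀ v : V, ∫ ξ, (ψ v : ℂ) * F (ξ + J v) = (ψ v : ℂ) * ∫ ξ, F ξ := fun v => by
      rw [integral_const_mul, integral_add_right_eq_self F (J v)]
    simp only [this]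
    rw [integral_mul_const, integral_complex_ofReal]
  have hP0 : ∀ ξ ∉ Metric.closedBall ξ₀ (ε + 2), P ξ = 0 := by
    intro ξ hξ
    have : ∀ v, (ψ v : ℂ) * F (ξ + J v) = 0 := fun v => by
      by_contra h
      exact hξ (hsupp v ξ h).2
    simp [P, this]
  let G : E → V × V → ℂ := fun ξ p =>
    ((ψ p.1 : ℂ) * F (ξ + J p.1)) * (starRingEnd ℂ) ((ψ p.2 : ℂ) * F (ξ + J p.2))
  have hGc : Continuous (Function.uncurry G) := by
    simp only [Function.uncurry_def, G]
    fun_prop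
  have hGs : HasCompactSupport (Function.uncurry G) :=
    HasCompactSupport.intro (hKc.prod (hkc.prod hkc)) (by
      rintro ⟨ξ, v, v'⟩ hn
      by_contra h
      have h1 := left_ne_zero_of_mul h
      have h2 := (map_ne_zero _).1 (right_ne_zero_of_mul h)
      exact hn ⟨(hsupp v ξ h1).2, (hsupp v ξ h1).1, (hsupp v' ξ h2).1⟩)
  have hPG : ∀ ξ, ((‖P ξ‖ ^ 2 : ℝ) : ℂ) = ∫ p, G ξ p := by
    intro ξ
    have h1 : ∫ p : V × V, G ξ p = P ξ * ∫ v, (starRingEnd ℂ) ((ψ v : ℂ) * F (ξ + J v)) :=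
      integral_prod_mul (fun v => (ψ v : ℂ) * F (ξ + J v))
        (fun v => (starRingEnd ℂ) ((ψ v : ℂ) * F (ξ + J v)))
    rw [h1, integral_conj, Complex.mul_conj, Complex.normSq_eq_norm_sq]
  have hGξ : ∀ p : V × V, ∫ ξ, G ξ p = ((ψ p.1 * ψ p.2 : ℝ) : ℂ) * autocorr J F (p.1 - p.2) := by
    intro p
    have h1 : autocorr J F (p.1 - p.2) =
        ∫ ξ, F (ξ + J p.1) * (starRingEnd ℂ) (F (ξ + J p.2)) := by
      rw [autocorr, ← integral_add_right_eq_self _ (J p.2)]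
      congr 1
      funext ξ
      rw [map_sub]
      congr 2
      abel_nf
    rw [h1, ← integral_const_mul]
    congr 1
    funext ξ
    simp only [G, map_mul, Complex.conj_ofReal, Complex.ofReal_mul]
    ring
  have hai := autocorr_integrable (J := J) hF hF0
  have hPsq : ∫ ξ, ‖P ξ‖ ^ 2 ≤ c * ∫ v, ‖autocorr J F v‖ := by
    have h1 : ((∫ ξ, ‖P ξ‖ ^ 2 : ℝ) : ℂ) =
        ∫ p : V × V, ((ψ p.1 * ψ p.2 : ℝ) : ℂ) * autocorr J F (p.1 - p.2) := by
      rw [← integral_complex_ofReal]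
      simp only [hPG]
      rw [integral_integral_swap_of_hasCompactSupport hGc hGs]
      simp only [hGξ]
    have h2 : ∫ ξ, ‖P ξ‖ ^ 2 ≤ ∫ p : V × V, ψ p.1 * ψ p.2 * ‖autocorr J F (p.1 - p.2)‖ := by
      have h3 := congrArg norm h1
      rw [Complex.norm_real, Real.norm_eq_abs] at h3
      refine (le_abs_self _).trans (h3.le.trans ((norm_integral_le_integral_norm _).trans_eq ?_))
      congr 1
      funext p
      rw [norm_mul, Complex.norm_real, Real.norm_eq_abs,
        abs_of_nonneg (mul_nonneg ψ.nonneg ψ.nonneg)]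
    refine h2.trans ?_
    have hac := autocorr_continuous (J := J) hF hF0
    have hinteg : Integrable (fun p : V × V => ψ p.1 * ψ p.2 * ‖autocorr J F (p.1 - p.2)‖) := by
      refine Continuous.integrable_of_hasCompactSupport (by fun_prop)
        (HasCompactSupport.intro (hkc.prod hkc) ?_)
      rintro ⟨v, v'⟩ hn
      by_contra h
      have h1 := left_ne_zero_of_mul (left_ne_zero_of_mul h)
      have h2 := right_ne_zero_of_mul (left_ne_zero_of_mul h)
      have key : ∀ v, ψ v ≠ 0 → v ∈ Metric.closedBall (0 : V) 2 := fun v hv => by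
        by_contra h1
        exact hv (ψ.zero_of_le_dist (not_le.1 h1).le)
      exact hn ⟨key _ h1, key _ h2⟩
    rw [Measure.volume_eq_prod, integral_prod _ hinteg]
    rw [hc, ← integral_mul_const]
    refine integral_mono_of_nonneg (Filter.Eventually.of_forall fun v => ?_)
      (hψi.mul_const _) (Filter.Eventually.of_forall fun v => ?_)
    · exact integral_nonneg fun v' => by
        have := ψ.nonneg (x := v)
        have := ψ.nonneg (x := v')
        positivity
    · simp only [mul_assoc]
      rw [integral_const_mul]
      refine mul_le_mul_of_nonneg_left ?_ ψ.nonneg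
      rw [← integral_sub_left_eq_self (fun u => ‖autocorr J F u‖) volume v]
      refine integral_mono_of_nonneg (Filter.Eventually.of_forall fun v' => ?_)
        ((hai.norm.comp_sub_left v)) (Filter.Eventually.of_forall fun v' => ?_)
      · exact mul_nonneg ψ.nonneg (norm_nonneg _)
      · exact mul_le_of_le_one_left (norm_nonneg _) ψ.le_one
  have hPc : Continuous P := by
    obtain ⟨C, hC⟩ := (HasCompactSupport.intro (isCompact_closedBall ξ₀ ε)
      hF0).exists_bound_of_continuous hF
    refine continuous_of_dominated (bound := fun v => ψ v * C) (fun ξ => ?_) (fun ξ => ?_)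
      (hψi.mul_const C) ?_
    · exact Continuous.aestronglyMeasurable (by fun_prop)
    · refine Filter.Eventually.of_forall fun v => ?_
      rw [norm_mul, Complex.norm_real, Real.norm_eq_abs, abs_of_nonneg ψ.nonneg]
      exact mul_le_mul_of_nonneg_left (hC _) ψ.nonneg
    · exact Filter.Eventually.of_forall fun v => by fun_prop
  have hP1 : ‖∫ ξ, P ξ‖ ≤ s * t + t⁻¹ * ∫ ξ, ‖P ξ‖ ^ 2 := by
    rw [← setIntegral_eq_integral_of_forall_compl_eq_zero (s := Metric.closedBall ξ₀ (ε + 2)) hP0]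
    have hi2 : Integrable fun ξ => ‖P ξ‖ ^ 2 :=
      (hPc.norm.pow 2).integrable_of_hasCompactSupport
        (HasCompactSupport.intro hKc fun ξ hξ => by simp [hP0 ξ hξ])
    have hic : IntegrableOn (fun _ : E => t) (Metric.closedBall ξ₀ (ε + 2)) :=
      integrableOn_const hKc.measure_lt_top.ne
    calc _ ≤ ∫ ξ in Metric.closedBall ξ₀ (ε + 2), ‖P ξ‖ := norm_integral_le_integral_norm _
      _ ≤ ∫ ξ in Metric.closedBall ξ₀ (ε + 2), (t + t⁻¹ * ‖P ξ‖ ^ 2) := by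
          refine integral_mono (hPc.norm.continuousOn.integrableOn_compact hKc)
            (hic.add (hi2.integrableOn.const_mul _))
            fun ξ => ?_
          have h1 : 0 ≤ t⁻¹ * (‖P ξ‖ - t) ^ 2 := by positivity
          have h2 : t⁻¹ * (‖P ξ‖ - t) ^ 2 = t⁻¹ * ‖P ξ‖ ^ 2 - 2 * ‖P ξ‖ + t := by
            field_simp; ring
          have := norm_nonneg (P ξ)
          simp only
          linarith
      _ = s * t + t⁻¹ * ∫ ξ in Metric.closedBall ξ₀ (ε + 2), ‖P ξ‖ ^ 2 := by
          rw [integral_add hic (hi2.integrableOn.const_mul _), integral_const_mul]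
          simp [hs, Measure.real]
      _ = _ := by
          rw [setIntegral_eq_integral_of_forall_compl_eq_zero]
          intro ξ hξ
          simp [hP0 ξ hξ]
  rw [hswap, norm_mul, Complex.norm_real, Real.norm_eq_abs, abs_of_pos hcpos] at hP1
  have hI : 0 ≤ ∫ v, ‖autocorr J F v‖ := integral_nonneg fun _ => norm_nonneg _
  have h6 : t⁻¹ * ∫ ξ, ‖P ξ‖ ^ 2 ≤ t⁻¹ * (c * ∫ v, ‖autocorr J F v‖) := by gcongr
  have hs0 : 0 ≤ s := ENNReal.toReal_nonneg
  rw [mul_assoc, le_inv_mul_iff₀ hcpos]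
  have h7 : 0 ≤ t⁻¹ * ∫ v, ‖autocorr J F v‖ := by positivity
  nlinarith [mul_nonneg hs0 h7, mul_nonneg hcpos.le ht.le]

end Differencing

section StationaryPhase

open scoped ContDiff

variable {E V : Type*} [NormedAddCommGroup E] [InnerProductSpace ℝ E] [FiniteDimensional ℝ E]
  [MeasurableSpace E] [BorelSpace E]
  [NormedAddCommGroup V] [InnerProductSpace ℝ V] [FiniteDimensional ℝ V]
  [MeasurableSpace V] [BorelSpace V]

/-- The oscillatory integral with amplitude `χ` and phase `r f + ⟪x, ·⟫`. -/
def oscInt (χ f : E → ℝ) (r : ℝ) (x : E) : ℂ :=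
  ∫ ξ, (χ ξ : ℂ) * Complex.exp (((r * f ξ + inner ℝ x ξ : ℝ) : ℂ) * Complex.I)

lemma le_one_add_pow_inv {D C y a : ℝ} {N : ℕ} (hD0 : 0 ≤ D) (hC0 : 0 ≤ C) (hy : 0 ≤ y)
    (hD : a ≤ D) (hC : 0 < y → a ≤ C * (y ^ N)⁻¹) :
    a ≤ 2 ^ N * (D + C) * ((1 + y) ^ N)⁻¹ := by
  have h2 : (0 : ℝ) < 2 ^ N := by positivity
  have h1y : 0 < (1 + y) ^ N := by positivity
  rw [le_mul_inv_iff₀ h1y]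
  rcases le_total y 1 with h | h
  · have : (1 + y) ^ N ≤ 2 ^ N := by gcongr; linarith
    calc a * (1 + y) ^ N ≤ D * 2 ^ N := by gcongr
      _ ≤ _ := by nlinarith
  · have hy0 : 0 < y := by linarith
    have : (1 + y) ^ N ≤ (2 * y) ^ N := by gcongr; linarith
    calc a * (1 + y) ^ N ≤ (C * (y ^ N)⁻¹) * (2 * y) ^ N := by
          gcongr
          exact hC hy0
      _ = 2 ^ N * C := by rw [mul_pow]; field_simp
      _ ≤ _ := by nlinarith

lemma oscInt_local_decay {f : E → ℝ} (hf : ContDiff ℝ ∞ f) (hb : BddDerivs f)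
    (J : V →ₗᵢ[ℝ] E) (ξ₀ : E)
    (hH : ∀ v : V, v ≠ 0 → fderiv ℝ (fderiv ℝ f) ξ₀ (J v) ≠ 0) :
    ∃ ε > 0, ∀ χ : E → ℝ, ContDiff ℝ ∞ χ → (∀ ξ ∉ Metric.closedBall ξ₀ ε, χ ξ = 0) →
      ∃ C, 0 ≤ C ∧ ∀ r : ℝ, 0 < r → ∀ x : E,
        ‖oscInt χ f r x‖ ≤ C * r ^ (-((Module.finrank ℝ V : ℝ) / 2)) := by
  obtain ⟨c, hc, ε, hε, hw⟩ := exists_direction_of_hessian hf J ξ₀ hH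
  refine ⟨ε, hε, fun χ hχ hχ0 => ?_⟩
  set m := Module.finrank ℝ V with hm
  obtain ⟨C₁, hC₁, hdec⟩ := differenced_decay hf hb J ξ₀ hc hε hw hχ hχ0 (m + 1)
  obtain ⟨C₂, hC₂, hmain⟩ := norm_integral_le_autocorr J ξ₀ ε
  have hχc : HasCompactSupport χ := HasCompactSupport.intro (isCompact_closedBall ξ₀ ε) hχ0
  obtain ⟨B, hB⟩ := hχc.exists_bound_of_continuous hχ.continuous
  have hB0 : 0 ≤ B := (norm_nonneg _).trans (hB 0)
  set D := ∫ ξ, B * ‖χ ξ‖ with hD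
  have hD0 : 0 ≤ D := integral_nonneg fun ξ => by positivity
  have hχi : Integrable fun ξ => B * ‖χ ξ‖ :=
    (hχ.continuous.norm.integrable_of_hasCompactSupport hχc.norm).const_mul B
  set K := 2 ^ (m + 1) * (D + C₁) with hK
  have hK0 : 0 ≤ K := by positivity
  set M := ∫ v : V, (1 + ‖v‖) ^ (-((m + 1 : ℕ) : ℝ)) with hM
  have hMint : Integrable fun v : V => (1 + ‖v‖) ^ (-((m + 1 : ℕ) : ℝ)) :=
    integrable_one_add_norm (by rw [← hm]; push_cast; linarith)
  have hM0 : 0 ≤ M := integral_nonneg fun v => by positivity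
  refine ⟨C₂ * (1 + K * M), by positivity, fun r hr x => ?_⟩
  let F : E → ℂ := fun ξ =>
    (χ ξ : ℂ) * Complex.exp (((r * f ξ + inner ℝ x ξ : ℝ) : ℂ) * Complex.I)
  have hFc : Continuous F := by
    have := hχ.continuous
    have := hf.continuous
    fun_prop
  have hF0 : ∀ ξ ∉ Metric.closedBall ξ₀ ε, F ξ = 0 := fun ξ hξ => by simp [F, hχ0 ξ hξ]
  have hauto : ∀ v : V, ‖autocorr J F v‖ ≤ K * ((1 + ‖r • v‖) ^ (m + 1))⁻¹ := by
    intro v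
    have hFF : ∀ ξ, F (ξ + J v) * (starRingEnd ℂ) (F ξ) =
        Complex.exp (((inner ℝ x (J v) : ℝ) : ℂ) * Complex.I) *
        (((χ (ξ + J v) * χ ξ : ℝ) : ℂ) *
          Complex.exp (((r * (f (ξ + J v) - f ξ) : ℝ) : ℂ) * Complex.I)) := by
      intro ξ
      simp only [F, map_mul, Complex.conj_ofReal, ← Complex.exp_conj, Complex.conj_I]
      rw [mul_mul_mul_comm, ← Complex.exp_add, mul_left_comm, ← Complex.exp_add, inner_add_right]
      push_cast
      congr 2
      ring
    have heq : ‖autocorr J F v‖ = ‖∫ ξ, ((χ (ξ + J v) * χ ξ : ℝ) : ℂ) *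
          Complex.exp (((r * (f (ξ + J v) - f ξ) : ℝ) : ℂ) * Complex.I)‖ := by
      rw [autocorr]
      simp only [hFF]
      rw [integral_const_mul, norm_mul, Complex.norm_exp_ofReal_mul_I, one_mul]
    refine le_one_add_pow_inv hD0 hC₁ (norm_nonneg _) ?_ fun hy => ?_
    · rw [heq]
      refine (norm_integral_le_integral_norm _).trans
        (integral_mono_of_nonneg (Filter.Eventually.of_forall fun _ => norm_nonneg _) hχi
          (Filter.Eventually.of_forall fun ξ => ?_))
      simp only
      rw [norm_mul, Complex.norm_exp_ofReal_mul_I, mul_one, Complex.norm_real, norm_mul]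
      exact mul_le_mul_of_nonneg_right (hB _) (norm_nonneg _)
    · have hv : v ≠ 0 := by
        rintro rfl
        simp at hy
      have hvn : ‖v‖ ≠ 0 := norm_ne_zero_iff.2 hv
      rw [heq]
      have h1 := hdec v hv ‖r • v‖ hy
      convert h1 using 7 with ξ
      rw [J.norm_map, norm_smul, Real.norm_eq_abs, abs_of_pos hr]
      field_simp
  have hinteg : ∫ v, ‖autocorr J F v‖ ≤ K * ((r ^ m)⁻¹ * M) := by
    have h1 : ∀ v : V, ((1 + ‖r • v‖) ^ (m + 1))⁻¹ =
        (fun v : V => (1 + ‖v‖) ^ (-((m + 1 : ℕ) : ℝ))) (r • v) := fun v => by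
      simp only
      rw [Real.rpow_neg (by positivity), Real.rpow_natCast]
    calc ∫ v, ‖autocorr J F v‖ ≤
          ∫ v, K * (fun v : V => (1 + ‖v‖) ^ (-((m + 1 : ℕ) : ℝ))) (r • v) := by
          refine integral_mono_of_nonneg (Filter.Eventually.of_forall fun _ => norm_nonneg _)
            ((hMint.comp_smul hr.ne').const_mul K) (Filter.Eventually.of_forall fun v => ?_)
          simp only
          have := hauto v
          rwa [h1] at this
      _ = _ := by
          rw [integral_const_mul, Measure.integral_comp_smul volume
            (fun v : V => (1 + ‖v‖) ^ (-((m + 1 : ℕ) : ℝ))) r, smul_eq_mul, ← hm,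
            abs_of_pos (by positivity)]
  set t := r ^ (-((m : ℝ) / 2)) with ht
  have ht0 : 0 < t := by positivity
  have htt : (r ^ m)⁻¹ = t * t := by
    rw [ht, ← Real.rpow_add hr, ← Real.rpow_natCast, ← Real.rpow_neg hr.le]
    congr 1
    ring
  calc ‖oscInt χ f r x‖ ≤ C₂ * (t + t⁻¹ * ∫ v, ‖autocorr J F v‖) := hmain F hFc hF0 t ht0
    _ ≤ C₂ * (t + t⁻¹ * (K * ((r ^ m)⁻¹ * M))) := by gcongr
    _ = C₂ * (1 + K * M) * t := by rw [htt]; field_simp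

lemma oscInt_add {f χ₁ χ₂ : E → ℝ} (hf : Continuous f) (h₁ : Continuous χ₁)
    (h₁' : HasCompactSupport χ₁) (h₂ : Continuous χ₂) (h₂' : HasCompactSupport χ₂) (r : ℝ) (x : E) :
    oscInt (fun ξ => χ₁ ξ + χ₂ ξ) f r x = oscInt χ₁ f r x + oscInt χ₂ f r x := by
  have key : ∀ χ : E → ℝ, Continuous χ → HasCompactSupport χ → Integrable fun ξ => (χ ξ : ℂ) *
      Complex.exp (((r * f ξ + inner ℝ x ξ : ℝ) : ℂ) * Complex.I) := fun χ h h' => by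
    refine Continuous.integrable_of_hasCompactSupport (by fun_prop) ?_
    exact (h'.comp_left (g := fun y : ℝ => (y : ℂ)) (by simp)).mul_right
  simp only [oscInt]
  rw [← integral_add (key χ₁ h₁ h₁') (key χ₂ h₂ h₂')]
  congr 1
  funext ξ
  push_cast
  ring

/-- Stationary phase bound for phases whose Hessian has rank at least `dim V` on a compact set. -/
theorem oscInt_decay {f : E → ℝ} (hf : ContDiff ℝ ∞ f) (hb : BddDerivs f) {K : Set E}
    (hK : IsCompact K)
    (hH : ∀ ξ₀ ∈ K, ∃ J : V →ₗᵢ[ℝ] E, ∀ v : V, v ≠ 0 → fderiv ℝ (fderiv ℝ f) ξ₀ (J v) ≠ 0)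
    {χ : E → ℝ} (hχ : ContDiff ℝ ∞ χ) (hχ0 : ∀ ξ ∉ K, χ ξ = 0) :
    ∃ C, 0 ≤ C ∧ ∀ r : ℝ, 0 < r → ∀ x : E,
      ‖oscInt χ f r x‖ ≤ C * r ^ (-((Module.finrank ℝ V : ℝ) / 2)) := by
  have hloc : ∀ ξ₀ ∈ K, ∃ ε > 0, ∀ χ : E → ℝ, ContDiff ℝ ∞ χ →
      (∀ ξ ∉ Metric.closedBall ξ₀ ε, χ ξ = 0) →
      ∃ C, 0 ≤ C ∧ ∀ r : ℝ, 0 < r → ∀ x : E,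
        ‖oscInt χ f r x‖ ≤ C * r ^ (-((Module.finrank ℝ V : ℝ) / 2)) := fun ξ₀ h => by
    obtain ⟨J, hJ⟩ := hH ξ₀ h
    exact oscInt_local_decay hf hb J ξ₀ hJ
  choose! ε hε hdec using hloc
  have hind : ∀ t : Finset E, (∀ y ∈ t, y ∈ K) → ∀ χ : E → ℝ, ContDiff ℝ ∞ χ →
      HasCompactSupport χ → (∀ ξ, χ ξ ≠ 0 → ∃ y ∈ t, ξ ∈ Metric.ball y (ε y / 2)) →
      ∃ C, 0 ≤ C ∧ ∀ r : ℝ, 0 < r → ∀ x : E,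
        ‖oscInt χ f r x‖ ≤ C * r ^ (-((Module.finrank ℝ V : ℝ) / 2)) := by
    intro t
    induction t using Finset.induction_on with
    | empty =>
      intro _ χ _ _ h0
      have : ∀ ξ, χ ξ = 0 := fun ξ => by
        by_contra h
        simpa using h0 ξ h
      exact ⟨0, le_rfl, fun r _ x => by simp [oscInt, this]⟩
    | insert y t _ ih =>
      intro htK χ hχ hχc h0
      have hyK : y ∈ K := htK y (Finset.mem_insert_self _ _)
      have hεy := hε y hyK
      let β : ContDiffBump y := ⟨ε y / 2, ε y, by positivity, by linarith⟩
      have hβs : ContDiff ℝ ∞ (β : E → ℝ) := β.contDiff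
      have h1s : ContDiff ℝ ∞ fun ξ => χ ξ * β ξ := hχ.mul hβs
      have h2s : ContDiff ℝ ∞ fun ξ => χ ξ * (1 - β ξ) := hχ.mul (contDiff_const.sub hβs)
      obtain ⟨C₁, hC₁, h₁⟩ := hdec y hyK (fun ξ => χ ξ * β ξ) h1s (fun ξ hξ => by
        have : β ξ = 0 := β.zero_of_le_dist (not_le.1 hξ).le
        simp [this])
      obtain ⟨C₂, hC₂, h₂⟩ := ih (fun z hz => htK z (Finset.mem_insert_of_mem hz))
        (fun ξ => χ ξ * (1 - β ξ)) h2s hχc.mul_right (fun ξ hξ => by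
          obtain ⟨z, hz, hz'⟩ := h0 ξ (left_ne_zero_of_mul hξ)
          rcases Finset.mem_insert.1 hz with rfl | hz
          · exfalso
            have : β ξ = 1 := β.one_of_mem_closedBall (Metric.ball_subset_closedBall hz')
            simp [this] at hξ
          · exact ⟨z, hz, hz'⟩)
      refine ⟨C₁ + C₂, by positivity, fun r hr x => ?_⟩
      have : oscInt χ f r x = oscInt (fun ξ => χ ξ * β ξ) f r x +
          oscInt (fun ξ => χ ξ * (1 - β ξ)) f r x := by
        rw [← oscInt_add hf.continuous h1s.continuous hχc.mul_right h2s.continuous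
          hχc.mul_right]
        congr 1
        funext ξ
        ring
      rw [this, add_mul]
      exact (norm_add_le _ _).trans (add_le_add (h₁ r hr x) (h₂ r hr x))
  obtain ⟨t, htK, hcov⟩ := hK.elim_nhds_subcover (fun y => Metric.ball y (ε y / 2))
    fun y hy => Metric.ball_mem_nhds y (by have := hε y hy; positivity)
  refine hind t htK χ hχ (HasCompactSupport.intro hK hχ0) fun ξ hξ => ?_
  have hξK : ξ ∈ K := by
    by_contra h
    exact hξ (hχ0 ξ h)
  simpa using hcov hξK

/-- Decay of the oscillatory integral when the linear part of the phase dominates. -/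
theorem oscInt_decay_far {f : E → ℝ} (hf : ContDiff ℝ ∞ f) (hb : BddDerivs f) {K : Set E}
    (hK : IsCompact K) {χ : E → ℝ} (hχ : ContDiff ℝ ∞ χ) (hχ0 : ∀ ξ ∉ K, χ ξ = 0) :
    ∃ A, 1 ≤ A ∧ ∀ N : ℕ, ∃ C, 0 ≤ C ∧ ∀ (r : ℝ) (x : E), x ≠ 0 → A * |r| ≤ ‖x‖ →
      ‖oscInt χ f r x‖ ≤ C * (‖x‖ ^ N)⁻¹ := by
  obtain ⟨B, hB⟩ := hb 1
  have hB0 : 0 ≤ B := (norm_nonneg _).trans (hB 0)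
  have hfd : ∀ ξ, ‖fderiv ℝ f ξ‖ ≤ B := fun ξ => by
    rw [← norm_iteratedFDeriv_one]
    exact hB ξ
  refine ⟨2 * B + 1, by linarith, fun N => ?_⟩
  let ι := {p : ℝ × E // p.2 ≠ 0 ∧ (2 * B + 1) * |p.1| ≤ ‖p.2‖}
  let W : ι → E := fun α => ‖α.1.2‖⁻¹ • α.1.2
  have hpos : ∀ α : ι, 0 < ‖α.1.2‖ := fun α => norm_pos_iff.2 α.2.1
  have hW : ∀ α, ‖W α‖ ≤ 1 := fun α => by
    simp [W, norm_smul, inv_mul_cancel₀ (hpos α).ne']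
  let s : ι → ℝ := fun α => ‖α.1.2‖⁻¹ * α.1.1
  have hs : ∀ α, (2 * B + 1) * |s α| ≤ 1 := fun α => by
    simp only [s]
    rw [abs_mul, abs_inv, abs_norm, mul_left_comm, inv_mul_le_iff₀ (hpos α), mul_one]
    exact α.2.2
  have hs1 : ∀ α, |s α| ≤ 1 := fun α => by nlinarith [hs α, abs_nonneg (s α)]
  let φ : ι → E → ℝ := fun α ξ => s α * f ξ + inner ℝ (W α) ξ
  have hφs : ∀ α, ContDiff ℝ ∞ (φ α) := fun α =>
    (contDiff_const.mul hf).add (contDiff_const.inner ℝ contDiff_id)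
  let u : ι → E → ℝ := fun α ξ => s α * dirD (W α) f ξ + 1
  have hdu : ∀ α, dirD (W α) (φ α) = u α := by
    intro α
    funext ξ
    have d1 := ((hf.differentiable (by simp) ξ).hasFDerivAt.const_mul (s α)).add
      ((innerSL ℝ (W α)).hasFDerivAt (x := ξ))
    have d2 : fderiv ℝ (φ α) ξ = _ := d1.fderiv
    have h1 : ‖W α‖ = 1 := by simp [W, norm_smul, inv_mul_cancel₀ (hpos α).ne']
    simp only [dirD, u]
    rw [d2]
    simp [h1]
  have hUB : ∀ {g : E → ℝ}, ContDiff ℝ ∞ g → BddDerivs g → ∀ n, UB W n (fun _ => g) :=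
    fun hg hgb => UB.of_iteratedFDeriv hW (fun _ => hg) fun k => by
      obtain ⟨C, hC⟩ := hgb k
      exact ⟨C, fun _ => hC⟩
  have hUc : ∀ (k : ι → ℝ), (∀ α, |k α| ≤ 1) → ∀ n, UB W n (fun α (_ : E) => k α) := fun k hk =>
    UB.of_iteratedFDeriv hW (fun _ => contDiff_const) (fun m => by
      rcases m with _ | m
      · exact ⟨1, fun α x => by simpa using hk α⟩
      · exact ⟨0, fun _ x => by simp [iteratedFDeriv_const_of_ne]⟩)
  have hus : ∀ α, ContDiff ℝ ∞ (u α) := fun α =>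
    (contDiff_const.mul hf.dirD).add contDiff_const
  have huU : ∀ n, UB W n u := fun n =>
    UB.add (fun α => contDiff_const.mul hf.dirD) (fun _ => contDiff_const)
      (UB.mul (fun _ => contDiff_const) (fun _ => hf.dirD) (hUc s hs1 n)
        (hUB hf hb (n + 1)).2) (hUc (fun _ => 1) (by simp) n)
  have hulow : ∀ α ξ, 1 / 2 ≤ u α ξ := by
    intro α ξ
    have h1 : |dirD (W α) f ξ| ≤ B := by
      calc _ ≤ ‖fderiv ℝ f ξ‖ * ‖W α‖ := ContinuousLinearMap.le_opNorm _ _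
        _ ≤ B * 1 := mul_le_mul (hfd ξ) (hW α) (norm_nonneg _) hB0
        _ = B := mul_one B
    have h2 : |s α * dirD (W α) f ξ| ≤ 1 / 2 := by
      rw [abs_mul]
      have := hs α
      have := mul_le_mul_of_nonneg_left h1 (abs_nonneg (s α))
      nlinarith [abs_nonneg (s α)]
    simp only [u]
    linarith [(abs_le.1 h2).1]
  obtain ⟨C, hC0, hC⟩ := nonstationary_phase (w := W) (S := fun _ => K) hK
    (fun _ => hK.isClosed) (fun _ => subset_rfl) (v := fun α ξ => (u α ξ)⁻¹) (φ := φ)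
    (fun α => (hus α).inv fun ξ => ne_of_gt (by linarith [hulow α ξ])) hφs
    (UB.inv (by norm_num) hus hulow huU) (by
      intro α ξ _
      rw [hdu]
      exact inv_mul_cancel₀ (ne_of_gt (by linarith [hulow α ξ]))) N
    (fun _ => χ) (fun _ => hχ)
    (hUB hχ (.of_hasCompactSupport hχ (HasCompactSupport.intro hK hχ0))) (fun _ => hχ0)
  refine ⟨C, hC0, fun r x hx hr => ?_⟩
  have h1 := hC ⟨(r, x), hx, hr⟩ ‖x‖ (norm_pos_iff.2 hx)
  have hxn : ‖x‖ ≠ 0 := norm_ne_zero_iff.2 hx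
  have h2 : ∀ ξ, r * f ξ + inner ℝ x ξ = ‖x‖ * φ ⟨(r, x), hx, hr⟩ ξ := fun ξ => by
    simp only [φ, s, W, real_inner_smul_left]
    field_simp
  simpa only [oscInt, h2] using h1

end StationaryPhase

section DistanceFunction

open scoped ContDiff

lemma norm_oscInt_neg {E : Type*} [NormedAddCommGroup E] [InnerProductSpace ℝ E]
    [FiniteDimensional ℝ E] [MeasurableSpace E] [BorelSpace E] (χ f : E → ℝ) (r : ℝ) (x : E) :
    ‖oscInt χ f (-r) x‖ = ‖oscInt χ f r (-x)‖ := by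
  rw [← RCLike.norm_conj (oscInt χ f (-r) x), oscInt, oscInt, ← integral_conj]
  congr 2
  funext ξ
  rw [map_mul, Complex.conj_ofReal, ← Complex.exp_conj, map_mul, Complex.conj_ofReal,
    Complex.conj_I, inner_neg_left]
  push_cast
  congr 2
  ring

/-- Combination of the trivial bound, the curvature decay and the off-cone decay. -/
lemma oscInt_bound_of_decay {E : Type*} [NormedAddCommGroup E] [InnerProductSpace ℝ E]
    [FiniteDimensional ℝ E] [MeasurableSpace E] [BorelSpace E] {χ f : E → ℝ}
    {s D A C₁ C₂ : ℝ} {n : ℕ} (hs : 0 ≤ s) (hsn : s ≤ n)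
    (hD0 : 0 ≤ D) (hA : 1 ≤ A) (hC₁ : 0 ≤ C₁) (hC₂ : 0 ≤ C₂)
    (hD : ∀ r x, ‖oscInt χ f r x‖ ≤ D)
    (h₁ : ∀ r : ℝ, 0 < r → ∀ x, ‖oscInt χ f r x‖ ≤ C₁ * r ^ (-s))
    (h₂ : ∀ (r : ℝ) (x : E), x ≠ 0 → A * |r| ≤ ‖x‖ →
      ‖oscInt χ f r x‖ ≤ C₂ * (‖x‖ ^ (n + 2 * n))⁻¹) (r : ℝ) (x : E) :
    ‖oscInt χ f r x‖ ≤ ((1 + A) ^ (2 * n) * 2 ^ s * (D + C₁) + 2 ^ (2 * n) * C₂) *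
      (1 + |r|) ^ (-s) * ((1 + ‖x‖ / (1 + |r|)) ^ (2 * n))⁻¹ := by
  set ρ := 1 + |r| with hρ
  have hρ1 : 1 ≤ ρ := by linarith [abs_nonneg r]
  have hρ0 : 0 < ρ := by linarith
  set y := ‖x‖ with hy
  have hy0 : 0 ≤ y := norm_nonneg x
  have hT : 0 < (1 + y / ρ) ^ (2 * n) := by positivity
  have hP : 0 < ρ ^ (-s) := by positivity
  have h2s : (0 : ℝ) < 2 ^ s := by positivity
  rw [le_mul_inv_iff₀ hT]
  rcases le_or_gt (A * ρ) y with h | h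
  · have hρy : ρ ≤ y := le_trans (by nlinarith) h
    have hy1 : 0 < y := by linarith
    have hx : x ≠ 0 := norm_pos_iff.1 hy1
    have hr : A * |r| ≤ y := le_trans (by nlinarith) h
    have e1 := h₂ r x hx hr
    have e2 : (1 + y / ρ) ^ (2 * n) ≤ (2 * y) ^ (2 * n) := by
      have : y / ρ ≤ y := div_le_self hy0 hρ1
      gcongr
      linarith
    have e3 : (y ^ n)⁻¹ ≤ ρ ^ (-s) := by
      rw [Real.rpow_neg hρ0.le]
      gcongr
      calc ρ ^ s ≤ ρ ^ (n : ℝ) := Real.rpow_le_rpow_of_exponent_le hρ1 hsn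
        _ = ρ ^ n := Real.rpow_natCast _ _
        _ ≤ y ^ n := by gcongr
    calc ‖oscInt χ f r x‖ * (1 + y / ρ) ^ (2 * n)
        ≤ (C₂ * (y ^ (n + 2 * n))⁻¹) * (2 * y) ^ (2 * n) := by gcongr
      _ = 2 ^ (2 * n) * C₂ * (y ^ n)⁻¹ := by
          rw [mul_pow, pow_add]
          field_simp
      _ ≤ 2 ^ (2 * n) * C₂ * ρ ^ (-s) := by gcongr
      _ ≤ _ := by
          gcongr
          have : 0 ≤ (1 + A) ^ (2 * n) * 2 ^ s * (D + C₁) := by positivity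
          linarith
  · have e2 : (1 + y / ρ) ^ (2 * n) ≤ (1 + A) ^ (2 * n) := by
      have : y / ρ ≤ A := by rw [div_le_iff₀ hρ0]; exact h.le
      gcongr
    have e1 : ‖oscInt χ f r x‖ ≤ 2 ^ s * (D + C₁) * ρ ^ (-s) := by
      rcases le_or_gt |r| 1 with hr | hr
      · have : 1 ≤ 2 ^ s * ρ ^ (-s) := by
          rw [Real.rpow_neg hρ0.le, ← div_eq_mul_inv, one_le_div (by positivity)]
          exact Real.rpow_le_rpow hρ0.le (by linarith) hs
        calc ‖oscInt χ f r x‖ ≤ D + C₁ := (hD r x).trans (by linarith)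
          _ ≤ (D + C₁) * (2 ^ s * ρ ^ (-s)) := le_mul_of_one_le_right (by linarith) this
          _ = _ := by ring
      · have hr0 : 0 < |r| := by linarith
        have e4 : |r| ^ (-s) ≤ 2 ^ s * ρ ^ (-s) := by
          rw [Real.rpow_neg hρ0.le, Real.rpow_neg hr0.le, ← div_eq_mul_inv,
            ← Real.div_rpow (by norm_num) hρ0.le, ← Real.inv_rpow hr0.le]
          refine Real.rpow_le_rpow (by positivity) ?_ hs
          rw [inv_le_comm₀ hr0 (by positivity), inv_div]
          linarith
        have e5 : ‖oscInt χ f r x‖ ≤ C₁ * |r| ^ (-s) := by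
          rcases abs_cases r with ⟨h', _⟩ | ⟨h', _⟩
          · rw [h']
            exact h₁ r (by linarith) x
          · have := h₁ (-r) (by linarith) (-x)
            rwa [norm_oscInt_neg, neg_neg, ← h'] at this
        calc ‖oscInt χ f r x‖ ≤ C₁ * (2 ^ s * ρ ^ (-s)) := e5.trans (by gcongr)
          _ ≤ (D + C₁) * (2 ^ s * ρ ^ (-s)) := by gcongr; linarith
          _ = _ := by ring
    calc ‖oscInt χ f r x‖ * (1 + y / ρ) ^ (2 * n)
        ≤ (2 ^ s * (D + C₁) * ρ ^ (-s)) * (1 + A) ^ (2 * n) := by gcongr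
      _ = (1 + A) ^ (2 * n) * 2 ^ s * (D + C₁) * ρ ^ (-s) := by ring
      _ ≤ _ := by
          gcongr
          have : 0 ≤ 2 ^ (2 * n) * C₂ := by positivity
          linarith

variable {d : ℕ} {a : Rd d → ℝ}

namespace IsDistFn

lemma map_zero (ha : IsDistFn a) : a 0 = 0 := by
  have := ha.homog 2 (by norm_num) 0
  rw [smul_zero] at this
  linarith

lemma contDiffAt (ha : IsDistFn a) {ξ : Rd d} (hξ : ξ ≠ 0) : ContDiffAt ℝ ∞ a ξ :=
  ha.smooth.contDiffAt (isOpen_ne.mem_nhds hξ)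

lemma eq_norm_mul (ha : IsDistFn a) {ξ : Rd d} (hξ : ξ ≠ 0) :
    a ξ = ‖ξ‖ * a (‖ξ‖⁻¹ • ξ) := by
  have h := norm_pos_iff.2 hξ
  rw [← ha.homog _ h, smul_smul, mul_inv_cancel₀ h.ne', one_smul]

lemma mem_sphere_of_ne {ξ : Rd d} (hξ : ξ ≠ 0) : ‖ξ‖⁻¹ • ξ ∈ Metric.sphere (0 : Rd d) 1 := by
  simp [norm_smul, hξ]

lemma continuousOn_sphere (ha : IsDistFn a) : ContinuousOn a (Metric.sphere (0 : Rd d) 1) :=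
  ha.smooth.continuousOn.mono fun ξ hξ => by
    rintro rfl
    simp at hξ

lemma exists_upper (ha : IsDistFn a) : ∃ M > 0, ∀ ξ, a ξ ≤ M * ‖ξ‖ := by
  obtain ⟨M, hM⟩ := (isCompact_sphere (0 : Rd d) 1).exists_bound_of_continuousOn
    ha.continuousOn_sphere
  refine ⟨|M| + 1, by positivity, fun ξ => ?_⟩
  rcases eq_or_ne ξ 0 with rfl | hξ
  · simp [ha.map_zero]
  · rw [ha.eq_norm_mul hξ, mul_comm]
    gcongr
    have := hM _ (mem_sphere_of_ne hξ)
    rw [Real.norm_eq_abs] at this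
    linarith [le_abs_self M, le_abs_self (a (‖ξ‖⁻¹ • ξ))]

lemma exists_lower (ha : IsDistFn a) : ∃ m > 0, ∀ ξ, m * ‖ξ‖ ≤ a ξ := by
  have hne : ∀ ξ ∈ Metric.sphere (0 : Rd d) 1, ξ ≠ 0 := fun ξ hξ => by
    rintro rfl
    simp at hξ
  obtain ⟨M, hM⟩ := (isCompact_sphere (0 : Rd d) 1).exists_bound_of_continuousOn
    (ha.continuousOn_sphere.inv₀ fun ξ hξ => (ha.pos ξ (hne ξ hξ)).ne')
  refine ⟨(|M| + 1)⁻¹, by positivity, fun ξ => ?_⟩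
  rcases eq_or_ne ξ 0 with rfl | hξ
  · simp [ha.map_zero]
  · have hS := mem_sphere_of_ne hξ
    have hp := ha.pos _ (hne _ hS)
    rw [ha.eq_norm_mul hξ, mul_comm]
    gcongr
    have := hM _ hS
    rw [Pi.inv_apply, norm_inv, Real.norm_eq_abs, abs_of_pos hp] at this
    rw [inv_le_comm₀ (by positivity) hp]
    linarith [le_abs_self M]

lemma continuous (ha : IsDistFn a) : Continuous a := by
  rw [continuous_iff_continuousAt]
  intro ξ
  rcases eq_or_ne ξ 0 with rfl | hξ
  · obtain ⟨M, hM, hu⟩ := ha.exists_upper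
    obtain ⟨m, hm, hl⟩ := ha.exists_lower
    rw [ContinuousAt, ha.map_zero]
    refine squeeze_zero (fun ξ => le_trans (by positivity) (hl ξ)) hu ?_
    have : Continuous fun ξ : Rd d => M * ‖ξ‖ := by fun_prop
    simpa using this.tendsto 0
  · exact (ha.contDiffAt hξ).continuousAt

lemma isCompact_shell (ha : IsDistFn a) (c C : ℝ) : IsCompact {ξ | a ξ ∈ Icc c C} := by
  obtain ⟨m, hm, hl⟩ := ha.exists_lower
  refine (isCompact_closedBall (0 : Rd d) (C / m)).of_isClosed_subset
    (isClosed_Icc.preimage ha.continuous) fun ξ hξ => ?_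
  rw [mem_closedBall_zero_iff, le_div_iff₀ hm, mul_comm]
  exact (hl ξ).trans hξ.2

lemma contDiff_comp {F : Type*} [NormedAddCommGroup F] [NormedSpace ℝ F] (ha : IsDistFn a)
    {g : ℝ → F} (hg : ContDiff ℝ ∞ g) {c : ℝ}
    (hc : 0 < c) (h0 : ∀ y < c, g y = 0) : ContDiff ℝ ∞ fun ξ => g (a ξ) := by
  rw [contDiff_iff_contDiffAt]
  intro ξ
  rcases eq_or_ne ξ 0 with rfl | hξ
  · have : ∀ᶠ ξ in nhds (0 : Rd d), a ξ < c :=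
      ha.continuous.continuousAt.eventually_lt continuousAt_const (by rwa [ha.map_zero])
    refine (contDiffAt_const (c := (0 : F))).congr_of_eventuallyEq ?_
    filter_upwards [this] with ξ hξ using h0 _ hξ
  · exact hg.contDiffAt.comp ξ (ha.contDiffAt hξ)

lemma fderiv_smul (ha : IsDistFn a) {t : ℝ} (ht : 0 < t) (ξ : Rd d) :
    fderiv ℝ a (t • ξ) = fderiv ℝ a ξ := by
  have h1 : (fun ξ => a (t • ξ)) = fun ξ => t • a ξ := by
    funext ξ
    rw [ha.homog t ht, smul_eq_mul]
  have h2 : fderiv ℝ (fun ξ => a (t • ξ)) ξ = t • fderiv ℝ a (t • ξ) := fderiv_comp_smul _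
  have h3 : fderiv ℝ (fun ξ => t • a ξ) ξ = t • fderiv ℝ a ξ :=
    congrFun (fderiv_const_smul_field (f := a) t) ξ
  rw [h1, h3] at h2
  exact (smul_right_injective _ ht.ne' h2).symm

lemma fderiv_fderiv_smul (ha : IsDistFn a) {t : ℝ} (ht : 0 < t) (ξ : Rd d) :
    fderiv ℝ (fderiv ℝ a) ξ = t • fderiv ℝ (fderiv ℝ a) (t • ξ) := by
  rw [← fderiv_comp_smul]
  congr 1
  funext ξ
  exact (ha.fderiv_smul ht ξ).symm

lemma fderiv_self (ha : IsDistFn a) {ξ : Rd d} (hξ : ξ ≠ 0) : fderiv ℝ a ξ ξ = a ξ := by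
  have h1 : HasDerivAt (fun t : ℝ => a (t • ξ)) (fderiv ℝ a ξ ξ) 1 := by
    have h2 : HasFDerivAt a (fderiv ℝ a ξ) ((1 : ℝ) • ξ) := by
      rw [one_smul]
      exact ((ha.contDiffAt hξ).differentiableAt (by simp)).hasFDerivAt
    have h3 : HasDerivAt (fun t : ℝ => t • ξ) ξ 1 := by
      simpa using (hasDerivAt_id (1 : ℝ)).smul_const ξ
    exact h2.comp_hasDerivAt 1 h3
  have h4 : HasDerivAt (fun t : ℝ => a (t • ξ)) (a ξ) 1 := by
    have : HasDerivAt (fun t : ℝ => t * a ξ) (a ξ) 1 := by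
      simpa using (hasDerivAt_id (1 : ℝ)).mul_const (a ξ)
    refine this.congr_of_eventuallyEq ?_
    filter_upwards [lt_mem_nhds (show (0 : ℝ) < 1 by norm_num)] with t ht using ha.homog t ht ξ
  exact h1.unique h4

lemma fderiv_fderiv_self (ha : IsDistFn a) {ξ : Rd d} (hξ : ξ ≠ 0) :
    fderiv ℝ (fderiv ℝ a) ξ ξ = 0 := by
  have h1 : HasDerivAt (fun t : ℝ => fderiv ℝ a (t • ξ)) (fderiv ℝ (fderiv ℝ a) ξ ξ) 1 := by
    have h2 : HasFDerivAt (fderiv ℝ a) (fderiv ℝ (fderiv ℝ a) ξ) ((1 : ℝ) • ξ) := by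
      rw [one_smul]
      exact (((ha.contDiffAt hξ).fderiv_right (m := ∞)
        (by simp)).differentiableAt (by simp)).hasFDerivAt
    have h3 : HasDerivAt (fun t : ℝ => t • ξ) ξ 1 := by
      simpa using (hasDerivAt_id (1 : ℝ)).smul_const ξ
    exact h2.comp_hasDerivAt 1 h3
  have h4 : HasDerivAt (fun t : ℝ => fderiv ℝ a (t • ξ)) 0 1 := by
    refine (hasDerivAt_const (1 : ℝ) (fderiv ℝ a ξ)).congr_of_eventuallyEq ?_
    filter_upwards [lt_mem_nhds (show (0 : ℝ) < 1 by norm_num)] with t ht using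
      ha.fderiv_smul ht ξ
  exact h1.unique h4

/-- The kernel of the Hessian of `a` is the radial direction. -/
lemma fderiv_fderiv_ne_zero (ha : IsDistFn a) (hcurv : CurvNondeg a) {ξ : Rd d} (hξ : ξ ≠ 0)
    {v : Rd d} (hv : v ≠ 0) (hvξ : inner ℝ ξ v = 0) : fderiv ℝ (fderiv ℝ a) ξ v ≠ 0 := by
  intro h
  have hp := ha.pos ξ hξ
  set t := (a ξ)⁻¹ with ht
  have ht0 : 0 < t := inv_pos.2 hp
  set ζ := t • ξ with hζ
  have hζ0 : ζ ≠ 0 := smul_ne_zero ht0.ne' hξ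
  have hζ1 : a ζ = 1 := by rw [hζ, ha.homog t ht0, ht, inv_mul_cancel₀ hp.ne']
  have h1 : fderiv ℝ (fderiv ℝ a) ζ v = 0 := by
    have := ha.fderiv_fderiv_smul ht0 ξ
    rw [this, smul_apply, smul_eq_zero] at h
    exact h.resolve_left ht0.ne'
  have h2 : fderiv ℝ a ζ ζ = 1 := by rw [ha.fderiv_self hζ0, hζ1]
  set w := v - (fderiv ℝ a ζ v) • ζ with hw
  have h3 : fderiv ℝ a ζ w = 0 := by simp [hw, h2]
  have h4 : fderiv ℝ (fderiv ℝ a) ζ w = 0 := by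
    simp [hw, h1, ha.fderiv_fderiv_self hζ0]
  rcases eq_or_ne w 0 with h5 | h5
  · have h6 : v = (fderiv ℝ a ζ v * t) • ξ := by
      rw [mul_smul]
      exact sub_eq_zero.1 h5
    rw [h6, inner_smul_right] at hvξ
    rcases mul_eq_zero.1 hvξ with h7 | h7
    · rw [h7, zero_smul] at h6
      exact hv h6
    · exact hξ (inner_self_eq_zero.1 h7)
  · obtain ⟨u, -, hu⟩ := hcurv ζ hζ1 w h3 h5
    rw [iteratedFDeriv_two_apply] at hu
    simp [h4] at hu

end IsDistFn

end DistanceFunction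

section KernelBound

open scoped ContDiff

variable {d : ℕ} {a : Rd d → ℝ} {η : ℝ → ℝ}

lemma IsDistFn.contDiff_bump (ha : IsDistFn a) (hη : IsBump η) :
    ContDiff ℝ ∞ fun ξ => η (a ξ) :=
  ha.contDiff_comp hη.smooth (c := 1 / 8) (by norm_num)
    fun y hy => hη.supp y fun h => absurd h.1 (not_le.2 hy)

/-- Uniform bounds for the kernel of `η(a)² e^{ira}`. -/
theorem exists_oscInt_bound (hd : 1 ≤ d) (ha : IsDistFn a) (hcurv : CurvNondeg a)
    (hη : IsBump η) : ∃ C, 0 ≤ C ∧ ∀ (r : ℝ) (x : Rd d),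
      ‖oscInt (fun ξ => η (a ξ) ^ 2) a r x‖ ≤
        C * (1 + |r|) ^ (-(((d : ℝ) - 1) / 2)) * ((1 + ‖x‖ / (1 + |r|)) ^ (2 * d))⁻¹ := by
  obtain ⟨n, rfl⟩ : ∃ n, d = n + 1 := ⟨d - 1, by omega⟩
  set K := {ξ : Rd (n + 1) | a ξ ∈ Icc (1 / 8 : ℝ) 8} with hKdef
  have hK : IsCompact K := ha.isCompact_shell _ _
  set χ : Rd (n + 1) → ℝ := fun ξ => η (a ξ) ^ 2 with hχdef
  have hχ : ContDiff ℝ ∞ χ := (ha.contDiff_bump hη).pow 2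
  have hχ0 : ∀ ξ ∉ K, χ ξ = 0 := fun ξ hξ => by simp [hχdef, hη.supp _ hξ]
  let κ : ContDiffBump (10 : ℝ) := ⟨9.95, 9.99, by norm_num, by norm_num⟩
  set g : ℝ → ℝ := fun y => κ y * y with hg
  have hgs : ContDiff ℝ ∞ g := κ.contDiff.mul contDiff_id
  have hg1 : ∀ y ∈ Metric.ball (10 : ℝ) 9.95, g y = y := fun y hy => by
    have : κ y = 1 := κ.one_of_mem_closedBall (Metric.ball_subset_closedBall hy)
    simp [hg, this]
  have hg0 : ∀ y : ℝ, 9.99 ≤ |y - 10| → g y = 0 := fun y hy => by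
    have : κ y = 0 := κ.zero_of_le_dist (by rw [Real.dist_eq]; exact hy)
    simp [hg, this]
  set f : Rd (n + 1) → ℝ := fun ξ => g (a ξ) with hfdef
  have hf : ContDiff ℝ ∞ f := ha.contDiff_comp hgs (c := 0.01) (by norm_num) fun y hy =>
    hg0 y (by rw [abs_of_neg (by linarith)]; linarith)
  have hfc : HasCompactSupport f := HasCompactSupport.intro (ha.isCompact_shell 0 20) fun ξ hξ => by
    refine hg0 _ ?_
    by_contra h
    rw [not_le, abs_lt] at h
    exact hξ ⟨by linarith, by linarith⟩
  have hfb : BddDerivs f := .of_hasCompactSupport hf hfc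
  have hKb : ∀ ξ ∈ K, a ξ ∈ Metric.ball (10 : ℝ) 9.95 := fun ξ hξ => by
    rw [Metric.mem_ball, Real.dist_eq, abs_lt]
    obtain ⟨h1, h2⟩ := hξ
    constructor <;> linarith
  have hfa : oscInt χ f = oscInt χ a := by
    funext r x
    refine integral_congr_ae (Filter.Eventually.of_forall fun ξ => ?_)
    by_cases hξ : ξ ∈ K
    · simp only [hfdef, hg1 _ (hKb ξ hξ)]
    · simp [hχ0 ξ hξ]
  have hH : ∀ ξ₀ ∈ K, ∃ J : EuclideanSpace ℝ (Fin n) →ₗᵢ[ℝ] Rd (n + 1),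
      ∀ v, v ≠ 0 → fderiv ℝ (fderiv ℝ f) ξ₀ (J v) ≠ 0 := by
    intro ξ₀ h₀
    have hne : ξ₀ ≠ 0 := by
      rintro rfl
      have := h₀.1
      rw [ha.map_zero] at this
      norm_num at this
    have hev : f =ᶠ[nhds ξ₀] a := by
      filter_upwards [ha.continuous.continuousAt.preimage_mem_nhds
        (Metric.isOpen_ball.mem_nhds (hKb ξ₀ h₀))] with ξ hξ using hg1 _ hξ
    have : Fact (Module.finrank ℝ (Rd (n + 1)) = n + 1) := ⟨by simp⟩
    let J₀ := (OrthonormalBasis.fromOrthogonalSpanSingleton (𝕜 := ℝ) n hne).repr.symm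
    refine ⟨(Submodule.subtypeₗᵢ _).comp J₀.toLinearIsometry, fun v hv => ?_⟩
    rw [hev.fderiv.fderiv_eq]
    refine ha.fderiv_fderiv_ne_zero hcurv hne ?_ ?_
    · simpa using hv
    · exact Submodule.mem_orthogonal_singleton_iff_inner_right.1 (J₀ v).2
  obtain ⟨C₁, hC₁, h₁⟩ := oscInt_decay hf hfb hK hH hχ hχ0
  obtain ⟨A, hA, hfar⟩ := oscInt_decay_far hf hfb hK hχ hχ0
  obtain ⟨C₂, hC₂, h₂⟩ := hfar (n + 1 + 2 * (n + 1))
  have hD : ∀ r x, ‖oscInt χ f r x‖ ≤ ∫ ξ, ‖χ ξ‖ := fun r x => by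
    refine (norm_integral_le_integral_norm _).trans_eq ?_
    congr 1
    funext ξ
    rw [norm_mul, Complex.norm_exp_ofReal_mul_I, mul_one, Complex.norm_real]
  have hdim : ((n + 1 : ℕ) : ℝ) - 1 = n := by push_cast; ring
  rw [hdim, ← hfa]
  simp only [finrank_euclideanSpace, Fintype.card_fin] at h₁
  refine ⟨_, ?_, oscInt_bound_of_decay (by positivity) ?_
    (integral_nonneg fun ξ => norm_nonneg _) hA hC₁ hC₂ hD h₁ h₂⟩
  · have := integral_nonneg (μ := volume) (f := fun ξ => ‖χ ξ‖) fun ξ => norm_nonneg _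
    positivity
  · push_cast
    have : (0 : ℝ) ≤ n := Nat.cast_nonneg n
    linarith

end KernelBound

section FourierSide

open scoped ContDiff

/-- Fubini for oscillatory double integrals. -/
lemma integral_mul_cexp_swap {X Y : Type*} [TopologicalSpace X] [TopologicalSpace Y]
    [SecondCountableTopology X] [SecondCountableTopology Y] [MeasurableSpace X] [BorelSpace X]
    [MeasurableSpace Y] [BorelSpace Y] {μ : Measure X} {ν : Measure Y} [SFinite μ] [SFinite ν]
    {g : X → ℂ} {h : Y → ℂ} (hg : Integrable g μ) (hh : Integrable h ν) {φ : X → Y → ℝ}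
    (hφ : Continuous fun p : X × Y => φ p.1 p.2) :
    ∫ x, g x * ∫ y, h y * Complex.exp ((φ x y : ℂ) * Complex.I) ∂ν ∂μ =
      ∫ y, h y * ∫ x, g x * Complex.exp ((φ x y : ℂ) * Complex.I) ∂μ ∂ν := by
  have hinteg : Integrable (fun p : X × Y =>
      g p.1 * h p.2 * Complex.exp ((φ p.1 p.2 : ℂ) * Complex.I)) (μ.prod ν) := by
    refine (hg.mul_prod hh).mul_bdd (c := 1) (Continuous.aestronglyMeasurable (by fun_prop))
      (Filter.Eventually.of_forall fun p => ?_)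
    rw [Complex.norm_exp_ofReal_mul_I]
  calc _ = ∫ x, ∫ y, g x * h y * Complex.exp ((φ x y : ℂ) * Complex.I) ∂ν ∂μ := by
        congr 1
        funext x
        rw [← integral_const_mul]
        congr 1
        funext y
        ring
    _ = ∫ y, ∫ x, g x * h y * Complex.exp ((φ x y : ℂ) * Complex.I) ∂μ ∂ν :=
        integral_integral_swap hinteg
    _ = _ := by
        congr 1
        funext y
        rw [← integral_const_mul]
        congr 1
        funext x
        ring

variable {d : ℕ} {a : Rd d → ℝ} {η : ℝ → ℝ}

lemma volume_qcube (z : Fin d → ℤ) : volume (qcube d z) = 1 := by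
  have h1 : qcube d z = (WithLp.ofLp) ⁻¹'
      (Set.univ.pi fun i => Ico (z i : ℝ) (z i + 1)) := by
    ext y
    simp [qcube]
  rw [h1, (PiLp.volume_preserving_ofLp (Fin d)).measure_preimage
    (MeasurableSet.univ_pi fun _ => measurableSet_Ico).nullMeasurableSet, Real.volume_pi_Ico]
  simp

lemma measurableSet_qcube (z : Fin d → ℤ) : MeasurableSet (qcube d z) := by
  have h1 : qcube d z = (WithLp.ofLp) ⁻¹'
      (Set.univ.pi fun i => Ico (z i : ℝ) (z i + 1)) := by
    ext y
    simp [qcube]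
  rw [h1]
  exact (PiLp.volume_preserving_ofLp (Fin d)).measurable
    (MeasurableSet.univ_pi fun _ => measurableSet_Ico)

lemma exists_norm_le_of_mem_qcube (z : Fin d → ℤ) : ∃ R, ∀ y ∈ qcube d z, ‖y‖ ≤ R := by
  refine ⟨√(∑ i, (|(z i : ℝ)| + 1) ^ 2), fun y hy => ?_⟩
  rw [EuclideanSpace.norm_eq]
  gcongr with i
  rw [Real.norm_eq_abs, abs_le]
  obtain ⟨h1, h2⟩ := hy i
  constructor <;> linarith [neg_abs_le (z i : ℝ), le_abs_self (z i : ℝ)]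

namespace IsNormalized

variable {z : Fin d → ℤ} {b : Rd d → ℂ}

lemma norm_le_indicator (hb : IsNormalized z b) (y : Rd d) :
    ‖b y‖ ≤ (qcube d z).indicator (fun _ => (1 : ℝ)) y := by
  by_cases h : y ∈ qcube d z
  · rw [indicator_of_mem h]
    exact hb.2.1 y
  · simp [hb.2.2 y h, h]

lemma integrable_indicator_qcube (z : Fin d → ℤ) :
    Integrable ((qcube d z).indicator fun _ => (1 : ℝ)) := by
  rw [integrable_indicator_iff (measurableSet_qcube z)]
  exact integrableOn_const (by simp [volume_qcube])

lemma integrable (hb : IsNormalized z b) : Integrable b :=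
  (integrable_indicator_qcube z).mono' hb.1.aestronglyMeasurable
    (Filter.Eventually.of_forall hb.norm_le_indicator)

lemma integral_norm_le (hb : IsNormalized z b) : ∫ y, ‖b y‖ ≤ 1 := by
  refine (integral_mono hb.integrable.norm (integrable_indicator_qcube z)
    hb.norm_le_indicator).trans_eq ?_
  rw [integral_indicator (measurableSet_qcube z)]
  simp [Measure.real, volume_qcube]

lemma contDiff_fourier (hb : IsNormalized z b) : ContDiff ℝ ∞ (𝓕 b) := by
  refine Real.contDiff_fourier fun n _ => ?_
  obtain ⟨R, hR⟩ := exists_norm_le_of_mem_qcube z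
  refine (hb.integrable.norm.const_mul (R ^ n)).mono'
    (Continuous.aestronglyMeasurable (by fun_prop) |>.mul
      hb.integrable.norm.aestronglyMeasurable) (Filter.Eventually.of_forall fun y => ?_)
  rw [norm_mul, norm_pow, norm_norm, norm_norm]
  by_cases h : y ∈ qcube d z
  · have := hR y h
    gcongr
  · simp [hb.2.2 y h]

end IsNormalized

/-- The Fourier transform of `K_r ∗ b`. -/
def symb (a : Rd d → ℝ) (η : ℝ → ℝ) (r : ℝ) (b : Rd d → ℂ) (ξ : Rd d) : ℂ :=
  (η (a ξ) : ℂ) * Complex.exp (((r * a ξ : ℝ) : ℂ) * Complex.I) * 𝓕 b ξ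

lemma contDiff_multiplier (ha : IsDistFn a) (hη : IsBump η) (r : ℝ) : ContDiff ℝ ∞ fun ξ =>
    (η (a ξ) : ℂ) * Complex.exp (((r * a ξ : ℝ) : ℂ) * Complex.I) := by
  refine ha.contDiff_comp (g := fun y : ℝ => (η y : ℂ) *
    Complex.exp (((r * y : ℝ) : ℂ) * Complex.I)) ?_ (c := 1 / 8) (by norm_num) fun y hy => ?_
  · have h1 : ContDiff ℝ ∞ fun y : ℝ => (η y : ℂ) := Complex.ofRealCLM.contDiff.comp hη.smooth
    have h2 : ContDiff ℝ ∞ fun y : ℝ => ((r * y : ℝ) : ℂ) :=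
      Complex.ofRealCLM.contDiff.comp (contDiff_const.mul contDiff_id)
    exact h1.mul (h2.mul contDiff_const).cexp
  · simp [hη.supp y fun h => absurd h.1 (not_le.2 hy)]

lemma hasCompactSupport_multiplier (ha : IsDistFn a) (hη : IsBump η) (r : ℝ) :
    HasCompactSupport fun ξ =>
      (η (a ξ) : ℂ) * Complex.exp (((r * a ξ : ℝ) : ℂ) * Complex.I) :=
  HasCompactSupport.intro (ha.isCompact_shell (1 / 8) 8) fun ξ hξ => by
    simp [hη.supp _ hξ]

lemma conv_Kker (ha : IsDistFn a) (hη : IsBump η) (r : ℝ) {b : Rd d → ℂ} (hb : Integrable b) :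
    conv (Kker a η r) b = 𝓕⁻ (symb a η r b) := by
  funext x
  have hm : Integrable fun ξ =>
      (η (a ξ) : ℂ) * Complex.exp (((r * a ξ : ℝ) : ℂ) * Complex.I) :=
    (contDiff_multiplier ha hη r).continuous.integrable_of_hasCompactSupport
      (hasCompactSupport_multiplier ha hη r)
  have hφ : Continuous fun p : Rd d × Rd d => (2 * π * inner ℝ (x - p.1) p.2 : ℝ) := by
    fun_prop
  rw [Real.fourierInv_eq', conv]
  calc _ = ∫ y, b y * ∫ ξ, ((η (a ξ) : ℂ) * Complex.exp (((r * a ξ : ℝ) : ℂ) * Complex.I)) *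
        Complex.exp (((2 * π * inner ℝ (x - y) ξ : ℝ) : ℂ) * Complex.I) := by
        congr 1
        funext y
        rw [mul_comm, Kker]
        congr 2
        funext ξ
        push_cast
        congr 2
        · congr 1
          ring
        · ring
    _ = _ := integral_mul_cexp_swap hb hm hφ
    _ = _ := by
        congr 1
        funext ξ
        rw [symb, Real.fourier_eq', smul_eq_mul, mul_left_comm]
        congr 1
        rw [← integral_const_mul]
        congr 1
        funext y
        rw [smul_eq_mul, ← mul_assoc, ← Complex.exp_add, mul_comm]
        congr 2
        rw [inner_sub_left, real_inner_comm ξ x]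
        push_cast
        ring

lemma integral_conj_symb_mul (ha : IsDistFn a) (hη : IsBump η) (r r' : ℝ) {b b' : Rd d → ℂ}
    (hb : Integrable b) (hb' : Integrable b') :
    ∫ ξ, (starRingEnd ℂ) (symb a η r b ξ) * symb a η r' b' ξ =
      ∫ p : Rd d × Rd d, (starRingEnd ℂ) (b p.1) * b' p.2 *
        oscInt (fun ξ => η (a ξ) ^ 2) a (r' - r) ((2 * π) • (p.1 - p.2)) ∂(volume.prod volume) := by
  have hbc : Integrable fun y => (starRingEnd ℂ) (b y) :=
    (Complex.conjLIE.toContinuousLinearEquiv.toContinuousLinearMap).integrable_comp hb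
  have hm : Integrable fun ξ => ((η (a ξ) ^ 2 : ℝ) : ℂ) *
      Complex.exp ((((r' - r) * a ξ : ℝ) : ℂ) * Complex.I) := by
    have h1 := (contDiff_multiplier ha hη (r' - r)).continuous.mul
      (Complex.continuous_ofReal.comp (ha.contDiff_bump hη).continuous)
    have h2 := (hasCompactSupport_multiplier ha hη (r' - r)).mul_right
      (f' := fun ξ => (η (a ξ) : ℂ))
    refine (h1.integrable_of_hasCompactSupport h2).congr (Filter.Eventually.of_forall fun ξ => ?_)
    simp only [Function.comp, Pi.mul_apply]
    push_cast
    ring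
  have hφ : Continuous fun p : Rd d × (Rd d × Rd d) =>
      (2 * π * inner ℝ (p.2.1 - p.2.2) p.1 : ℝ) := by
    fun_prop
  have hF : ∀ ξ, (starRingEnd ℂ) (𝓕 b ξ) * 𝓕 b' ξ = ∫ p : Rd d × Rd d,
      (starRingEnd ℂ) (b p.1) * b' p.2 *
      Complex.exp (((2 * π * inner ℝ (p.1 - p.2) ξ : ℝ) : ℂ) * Complex.I)
        ∂(volume.prod volume) := by
    intro ξ
    rw [Real.fourier_eq', Real.fourier_eq', ← integral_conj, ← integral_prod_mul]
    congr 1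
    funext p
    rw [smul_eq_mul, smul_eq_mul, map_mul, ← Complex.exp_conj, map_mul, Complex.conj_ofReal,
      Complex.conj_I, mul_mul_mul_comm, ← Complex.exp_add, mul_comm, inner_sub_left]
    congr 2
    push_cast
    ring
  calc _ = ∫ ξ, (((η (a ξ) ^ 2 : ℝ) : ℂ) *
        Complex.exp ((((r' - r) * a ξ : ℝ) : ℂ) * Complex.I)) *
          ∫ p : Rd d × Rd d, (starRingEnd ℂ) (b p.1) * b' p.2 *
      Complex.exp (((2 * π * inner ℝ (p.1 - p.2) ξ : ℝ) : ℂ) * Complex.I)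
        ∂(volume.prod volume) := by
        congr 1
        funext ξ
        rw [← hF, symb, symb]
        simp only [map_mul, Complex.conj_ofReal, ← Complex.exp_conj, Complex.conj_I]
        have : Complex.exp ((((r' - r) * a ξ : ℝ) : ℂ) * Complex.I) =
            Complex.exp (((r * a ξ : ℝ) : ℂ) * -Complex.I) *
            Complex.exp (((r' * a ξ : ℝ) : ℂ) * Complex.I) := by
          rw [← Complex.exp_add]
          congr 1
          push_cast
          ring
        rw [this]
        push_cast
        ring
    _ = _ := integral_mul_cexp_swap hm (hbc.mul_prod hb') hφ
    _ = _ := by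
        congr 1
        funext p
        rw [oscInt]
        congr 2
        funext ξ
        rw [mul_assoc, ← Complex.exp_add, real_inner_smul_left]
        congr 2
        push_cast
        ring

end FourierSide

section Correlations

/-- The decay profile of the correlations of the functions `K_n ∗ b_{n,z}`. -/
def corrWeight {d : ℕ} (r : ℝ) (ζ : Fin d → ℤ) : ℝ :=
  (1 + |r|) ^ (-(((d : ℝ) - 1) / 2)) * ∏ i, ((1 + |(ζ i : ℝ)| / (1 + |r|)) ^ 2)⁻¹

variable {d : ℕ} {a : Rd d → ℝ} {η : ℝ → ℝ}

lemma inv_pow_le_prod_of_mem_qcube {z z' : Fin d → ℤ} {y y' : Rd d} (hy : y ∈ qcube d z)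
    (hy' : y' ∈ qcube d z') {ρ : ℝ} (hρ : 1 ≤ ρ) :
    ((1 + ‖(2 * π) • (y - y')‖ / ρ) ^ (2 * d))⁻¹ ≤
      4 ^ d * ∏ i, ((1 + |((z i - z' i : ℤ) : ℝ)| / ρ) ^ 2)⁻¹ := by
  have hρ0 : 0 < ρ := by linarith
  set T := 1 + ‖(2 * π) • (y - y')‖ / ρ with hT
  have hT0 : 0 < T := by positivity
  have h1 : ∀ i, 1 + |((z i - z' i : ℤ) : ℝ)| / ρ ≤ 2 * T := by
    intro i
    have h2 : |((z i - z' i : ℤ) : ℝ)| ≤ |y i - y' i| + 1 := by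
      obtain ⟨h3, h4⟩ := hy i
      obtain ⟨h5, h6⟩ := hy' i
      push_cast
      rw [abs_le]
      constructor <;> linarith [neg_abs_le (y i - y' i), le_abs_self (y i - y' i)]
    have h3 : |y i - y' i| ≤ ‖(2 * π) • (y - y')‖ := by
      have h4 : |y i - y' i| ≤ ‖y - y'‖ := PiLp.norm_apply_le (y - y') i
      rw [norm_smul, Real.norm_of_nonneg (by positivity)]
      refine h4.trans (le_mul_of_one_le_left (norm_nonneg _) ?_)
      linarith [Real.pi_gt_three]
    have h4 : |((z i - z' i : ℤ) : ℝ)| / ρ ≤ ‖(2 * π) • (y - y')‖ / ρ + 1 := by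
      rw [div_add_one hρ0.ne']
      gcongr
      linarith
    have : 0 ≤ ‖(2 * π) • (y - y')‖ / ρ := by positivity
    linarith
  calc (T ^ (2 * d))⁻¹ = 4 ^ d * ∏ _i : Fin d, ((2 * T) ^ 2)⁻¹ := by
        rw [Finset.prod_const, Finset.card_univ, Fintype.card_fin, mul_pow, mul_inv, mul_pow,
          ← mul_assoc, ← mul_pow, pow_mul, inv_pow]
        norm_num
    _ ≤ _ := by
        gcongr with i
        exact h1 i

lemma norm_integral_conj_symb_mul_le (ha : IsDistFn a) (hη : IsBump η) {C : ℝ} (hC : 0 ≤ C)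
    (hosc : ∀ (r : ℝ) (x : Rd d), ‖oscInt (fun ξ => η (a ξ) ^ 2) a r x‖ ≤
        C * (1 + |r|) ^ (-(((d : ℝ) - 1) / 2)) * ((1 + ‖x‖ / (1 + |r|)) ^ (2 * d))⁻¹)
    (r r' : ℝ) {z z' : Fin d → ℤ} {b b' : Rd d → ℂ} (hb : IsNormalized z b)
    (hb' : IsNormalized z' b') :
    ‖∫ ξ, (starRingEnd ℂ) (symb a η r b ξ) * symb a η r' b' ξ‖ ≤
      C * 4 ^ d * corrWeight (r' - r) (fun i => z i - z' i) := by
  rw [integral_conj_symb_mul ha hη r r' hb.integrable hb'.integrable]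
  set W := C * 4 ^ d * corrWeight (r' - r) (fun i => z i - z' i) with hW
  have hW0 : 0 ≤ W := by
    have : 0 ≤ corrWeight (r' - r) (fun i => z i - z' i) :=
      mul_nonneg (by positivity) (Finset.prod_nonneg fun i _ => by positivity)
    positivity
  calc _ ≤ ∫ p : Rd d × Rd d, W * (‖b p.1‖ * ‖b' p.2‖) ∂(volume.prod volume) := by
        refine norm_integral_le_of_norm_le
          ((hb.integrable.norm.mul_prod hb'.integrable.norm).const_mul W)
          (Filter.Eventually.of_forall fun p => ?_)
        rw [norm_mul, norm_mul, RCLike.norm_conj, mul_comm]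
        by_cases h : p.1 ∈ qcube d z
        · by_cases h' : p.2 ∈ qcube d z'
          · gcongr
            refine (hosc _ _).trans ?_
            have := inv_pow_le_prod_of_mem_qcube h h' (ρ := 1 + |r' - r|)
              (by linarith [abs_nonneg (r' - r)])
            calc _ ≤ C * (1 + |r' - r|) ^ (-(((d : ℝ) - 1) / 2)) *
                  (4 ^ d * ∏ i, ((1 + |((z i - z' i : ℤ) : ℝ)| / (1 + |r' - r|)) ^ 2)⁻¹) := by
                  gcongr
              _ = W := by
                  rw [hW, corrWeight]
                  ring
          · simp [hb'.2.2 _ h']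
        · simp [hb.2.2 _ h]
    _ = W * ((∫ y, ‖b y‖) * ∫ y, ‖b' y‖) := by
        rw [integral_const_mul, integral_prod_mul (fun y => ‖b y‖) (fun y => ‖b' y‖)]
    _ ≤ W * (1 * 1) := by
        have h1 : 0 ≤ ∫ y, ‖b' y‖ := integral_nonneg fun y => norm_nonneg (b' y)
        exact mul_le_mul_of_nonneg_left
          (mul_le_mul hb.integral_norm_le hb'.integral_norm_le h1 zero_le_one) hW0
    _ = W := by ring

/-- The functions `K_n ∗ b_{n,z}` as vectors of `L²` with decaying correlations. -/
theorem exists_vectors (hd : 1 ≤ d) (ha : IsDistFn a) (hcurv : CurvNondeg a) (hη : IsBump η) :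
    ∃ C, 0 ≤ C ∧ ∀ b : ℕ × (Fin d → ℤ) → Rd d → ℂ, (∀ e, IsNormalized e.2 (b e)) →
      ∃ u : ℕ × (Fin d → ℤ) → Lp ℂ 2 (volume : Measure (Rd d)),
        (∀ e e', ‖inner ℂ (u e) (u e')‖ ≤
          C * corrWeight ((e'.1 : ℝ) - e.1) (fun i => e.2 i - e'.2 i)) ∧
        ∀ E : Finset (ℕ × (Fin d → ℤ)),
          eLpNorm (fun x : Rd d => ∑ e ∈ E, conv (Kker a η (e.1 : ℝ)) (b e) x) 2 volume =
            ENNReal.ofReal ‖∑ e ∈ E, u e‖ := by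
  obtain ⟨C, hC, hosc⟩ := exists_oscInt_bound hd ha hcurv hη
  refine ⟨C * 4 ^ d, by positivity, fun b hb => ?_⟩
  have hs : ∀ e, HasCompactSupport (symb a η (e.1 : ℝ) (b e)) := fun e =>
    (hasCompactSupport_multiplier ha hη _).mul_right
  let S : ℕ × (Fin d → ℤ) → SchwartzMap (Rd d) ℂ := fun e =>
    (hs e).toSchwartzMap ((contDiff_multiplier ha hη _).mul (hb e).contDiff_fourier)
  have hS : ∀ e, (S e : Rd d → ℂ) = symb a η (e.1 : ℝ) (b e) := fun e => rfl
  have hw : ∀ e, ((𝓕⁻ (S e) : SchwartzMap (Rd d) ℂ) : Rd d → ℂ) =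
      conv (Kker a η (e.1 : ℝ)) (b e) := fun e => by
    rw [SchwartzMap.fourierInv_coe, hS, conv_Kker ha hη _ (hb e).integrable]
  refine ⟨fun e => (𝓕⁻ (S e)).toLp 2, fun e e' => ?_, fun E => ?_⟩
  · rw [← SchwartzMap.inner_fourier_toL2_eq (𝓕⁻ (S e)) (𝓕⁻ (S e')),
      FourierTransform.fourier_fourierInv_eq, FourierTransform.fourier_fourierInv_eq,
      SchwartzMap.inner_toL2_toL2_eq (S e) (S e') volume]
    refine le_trans (le_of_eq ?_)
      (norm_integral_conj_symb_mul_le ha hη hC hosc (e.1 : ℝ) (e'.1 : ℝ) (hb e) (hb e'))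
    congr 2
    funext ξ
    rw [RCLike.inner_apply, mul_comm]
    rfl
  · have h1 : ∑ e ∈ E, (𝓕⁻ (S e)).toLp 2 (volume : Measure (Rd d)) =
        (∑ e ∈ E, 𝓕⁻ (S e)).toLp 2 (volume : Measure (Rd d)) := by
      exact (map_sum (SchwartzMap.toLpCLM ℂ ℂ 2 (volume : Measure (Rd d)))
        (fun e => 𝓕⁻ (S e)) E).symm
    rw [h1, SchwartzMap.norm_toLp, ENNReal.ofReal_toReal (SchwartzMap.memLp _ _ _).2.ne]
    congr 1
    funext x
    rw [sum_apply]
    exact Finset.sum_congr rfl fun e _ => (congrFun (hw e) x).symm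

end Correlations

section LatticeSums

variable {d : ℕ}

/-- The one-dimensional lattice sum `∑_k (1 + |k|)^{-2}`. -/
def latSum : ℝ := ∑' k : ℤ, ((1 + |(k : ℝ)|) ^ 2)⁻¹

lemma summable_latSum : Summable fun k : ℤ => ((1 + |(k : ℝ)|) ^ 2)⁻¹ := by
  have h : Summable fun n : ℕ => ((1 + (n : ℝ)) ^ 2)⁻¹ := by
    have := (summable_nat_add_iff 1).2 (Real.summable_nat_pow_inv.2 one_lt_two)
    refine this.congr fun n => ?_
    push_cast
    ring
  refine .of_nat_of_neg ?_ ?_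
  · simpa using h
  · simpa using h

lemma latSum_nonneg : 0 ≤ latSum := tsum_nonneg fun _ => by positivity

lemma sum_prod_lattice_le (T : Finset (Fin d → ℤ)) :
    ∑ ζ ∈ T, ∏ i, ((1 + |(ζ i : ℝ)|) ^ 2)⁻¹ ≤ latSum ^ d := by
  set U : Finset ℤ := T.biUnion fun ζ => Finset.univ.image ζ with hU
  have hsub : T ⊆ Fintype.piFinset fun _ => U := fun ζ hζ => by
    rw [Fintype.mem_piFinset]
    exact fun i => Finset.mem_biUnion.2 ⟨ζ, hζ, Finset.mem_image_of_mem _ (Finset.mem_univ i)⟩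
  calc _ ≤ ∑ ζ ∈ Fintype.piFinset fun _ : Fin d => U, ∏ i, ((1 + |(ζ i : ℝ)|) ^ 2)⁻¹ :=
        Finset.sum_le_sum_of_subset_of_nonneg hsub fun ζ _ _ =>
          Finset.prod_nonneg fun i _ => by positivity
    _ = ∏ _i : Fin d, ∑ k ∈ U, ((1 + |(k : ℝ)|) ^ 2)⁻¹ :=
        (Finset.prod_univ_sum (fun _ : Fin d => U) fun _ k => ((1 + |(k : ℝ)|) ^ 2)⁻¹).symm
    _ = (∑ k ∈ U, ((1 + |(k : ℝ)|) ^ 2)⁻¹) ^ d := by simp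
    _ ≤ latSum ^ d := by
        gcongr
        exact summable_latSum.sum_le_tsum _ fun _ _ => by positivity

lemma sum_corrWeight_zero_le (F : Finset (ℕ × (Fin d → ℤ))) (n : ℕ) (hF : ∀ e ∈ F, e.1 = n)
    (z : Fin d → ℤ) : ∑ e ∈ F, corrWeight 0 (fun i => z i - e.2 i) ≤ latSum ^ d := by
  have hinj : Set.InjOn (fun e : ℕ × (Fin d → ℤ) => fun i => z i - e.2 i) F := by
    intro e he e' he' h
    refine Prod.ext ((hF e he).trans (hF e' he').symm) (funext fun i => ?_)
    have := congrFun h i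
    simp only at this
    linarith
  refine le_trans (le_of_eq ?_) (sum_prod_lattice_le
    (F.image fun e : ℕ × (Fin d → ℤ) => fun i => z i - e.2 i))
  rw [Finset.sum_image hinj]
  simp [corrWeight]

lemma embedPt_injective : Function.Injective (embedPt d) := by
  intro e e' h
  simp only [embedPt, Prod.mk.injEq, Nat.cast_inj] at h
  refine Prod.ext h.1 (funext fun i => ?_)
  exact_mod_cast congrFun h.2 i

/-- The number of points of `E` in a dyadic cube of side length `2^k`. -/
lemma card_filter_dyadic_le {j k : ℕ} (hk1 : 1 ≤ k) (hkj : k ≤ j) {L : ℝ}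
    {E : Finset (ℕ × (Fin d → ℤ))}
    (hE : ∀ e ∈ E, (2 : ℝ) ^ j ≤ (e.1 : ℝ) ∧ (e.1 : ℝ) < 2 ^ (j + 1))
    (hQ : ∀ Q : DyCube d j, (cubeCount (E.image (embedPt d)) Q : ℝ) ≤ L * Q.len)
    {e₀ : ℕ × (Fin d → ℤ)} (h₀ : e₀ ∈ E) :
    ((E.filter fun e => (e.1 : ℤ) / 2 ^ k = (e₀.1 : ℤ) / 2 ^ k ∧
      ∀ i, e.2 i / 2 ^ k = e₀.2 i / 2 ^ k).card : ℝ) ≤ L * 2 ^ k := by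
  have h2k : (0 : ℤ) < 2 ^ k := by positivity
  have hb := hE e₀ h₀
  have hb1 : (2 : ℤ) ^ j ≤ e₀.1 := by exact_mod_cast hb.1
  have hb2 : (e₀.1 : ℤ) < 2 ^ (j + 1) := by exact_mod_cast hb.2
  let Q : DyCube d j := ⟨k, (e₀.1 : ℤ) / 2 ^ k, fun i => e₀.2 i / 2 ^ k, ⟨hk1, hkj⟩, by
    constructor
    · rw [Int.le_ediv_iff_mul_le h2k, ← pow_add, Nat.sub_add_cancel hkj]
      exact hb1
    · rw [Int.ediv_lt_iff_lt_mul h2k, ← pow_add, Nat.sub_add_cancel (by omega)]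
      exact hb2⟩
  have hmem : ∀ x : ℤ, ((x / 2 ^ k : ℤ) : ℝ) * 2 ^ k ≤ x ∧
      (x : ℝ) < ((x / 2 ^ k : ℤ) + 1) * 2 ^ k := by
    intro x
    have h1 : x / 2 ^ k * 2 ^ k ≤ x := Int.ediv_mul_le x h2k.ne'
    have h2 : x < (x / 2 ^ k + 1) * 2 ^ k := Int.lt_ediv_add_one_mul_self x h2k
    constructor
    · exact_mod_cast h1
    · exact_mod_cast h2
  refine le_trans ?_ (hQ Q)
  rw [Nat.cast_le, cubeCount]
  refine Finset.card_le_card_of_injOn (embedPt d) (fun e he => ?_) embedPt_injective.injOn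
  obtain ⟨h1, h2, h3⟩ := Finset.mem_filter.1 he
  refine Finset.mem_filter.2 ⟨Finset.mem_image_of_mem _ h1, ?_, fun i => ?_⟩
  · have := hmem e.1
    rw [h2, Int.cast_natCast] at this
    exact this
  · have := hmem (e.2 i)
    rw [h3] at this
    exact this

lemma abs_ediv_sub_le {x y D : ℤ} (hD : 0 < D) :
    |((x / D - y / D : ℤ) : ℝ)| ≤ |((x - y : ℤ) : ℝ)| / D + 1 := by
  have hD' : (0 : ℝ) < D := by exact_mod_cast hD
  rw [div_add_one hD'.ne', le_div_iff₀ hD', ← abs_of_pos hD', ← abs_mul, abs_of_pos hD']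
  have h : |(x / D - y / D) * D| ≤ |x - y| + D := by
    have h1 : x / D * D ≤ x := Int.ediv_mul_le x hD.ne'
    have h2 : x < (x / D + 1) * D := Int.lt_ediv_add_one_mul_self x hD
    have h3 : y / D * D ≤ y := Int.ediv_mul_le y hD.ne'
    have h4 : y < (y / D + 1) * D := Int.lt_ediv_add_one_mul_self y hD
    rw [abs_le]
    constructor <;> nlinarith [neg_abs_le (x - y), le_abs_self (x - y)]
  exact_mod_cast h

/-- The contribution of a dyadic shell. -/
lemma sum_shell_le {j k : ℕ} (hk1 : 1 ≤ k) (hkj : k ≤ j) (hd : 1 ≤ d) {L : ℝ} (hL : 0 ≤ L)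
    {E : Finset (ℕ × (Fin d → ℤ))}
    (hE : ∀ e ∈ E, (2 : ℝ) ^ j ≤ (e.1 : ℝ) ∧ (e.1 : ℝ) < 2 ^ (j + 1))
    (hQ : ∀ Q : DyCube d j, (cubeCount (E.image (embedPt d)) Q : ℝ) ≤ L * Q.len)
    (e : ℕ × (Fin d → ℤ)) {F : Finset (ℕ × (Fin d → ℤ))} (hFE : F ⊆ E)
    (hF : ∀ e' ∈ F, 2 ^ (k - 1) ≤ |(e'.1 : ℤ) - e.1| ∧ |(e'.1 : ℤ) - e.1| < 2 ^ k) :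
    ∑ e' ∈ F, corrWeight ((e'.1 : ℝ) - e.1) (fun i => e.2 i - e'.2 i) ≤
      2 ^ (((d : ℝ) - 1) / 2) * 4 ^ d * 3 * latSum ^ d * L *
        ((2 : ℝ) ^ k) ^ (1 - ((d : ℝ) - 1) / 2) := by
  set s := ((d : ℝ) - 1) / 2 with hs
  have hs0 : 0 ≤ s := by
    have : (1 : ℝ) ≤ d := by exact_mod_cast hd
    rw [hs]
    linarith
  have h2k : (0 : ℤ) < 2 ^ k := by positivity
  have h2kR : (0 : ℝ) < 2 ^ k := by positivity
  let q : ℕ × (Fin d → ℤ) → ℤ × (Fin d → ℤ) := fun e' =>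
    ((e'.1 : ℤ) / 2 ^ k - (e.1 : ℤ) / 2 ^ k, fun i => e.2 i / 2 ^ k - e'.2 i / 2 ^ k)
  let h : ℤ × (Fin d → ℤ) → ℝ := fun x => ∏ i, ((1 + |(x.2 i : ℝ)|) ^ 2)⁻¹
  have hh0 : ∀ x, 0 ≤ h x := fun x => Finset.prod_nonneg fun i _ => by positivity
  have hW : ∀ e' ∈ F, corrWeight ((e'.1 : ℝ) - e.1) (fun i => e.2 i - e'.2 i) ≤
      (2 ^ s * ((2 : ℝ) ^ k) ^ (-s) * 4 ^ d) * h (q e') := by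
    intro e' he'
    obtain ⟨hl, hu⟩ := hF e' he'
    set ρ := 1 + |(e'.1 : ℝ) - e.1| with hρ
    have hρ0 : 0 < ρ := by positivity
    have hl' : (2 : ℝ) ^ k ≤ 2 * ρ := by
      have h1 : (2 : ℝ) ^ (k - 1) ≤ |(e'.1 : ℝ) - e.1| := by exact_mod_cast hl
      have h2 : (2 : ℝ) ^ k = 2 * 2 ^ (k - 1) := by
        rw [← pow_succ', Nat.sub_add_cancel hk1]
      rw [h2]
      linarith
    have hu' : ρ ≤ 2 ^ k := by
      have h1 : 1 + |(e'.1 : ℤ) - e.1| ≤ 2 ^ k := by linarith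
      have h2 : ((1 + |(e'.1 : ℤ) - e.1| : ℤ) : ℝ) ≤ ((2 ^ k : ℤ) : ℝ) := Int.cast_le.2 h1
      push_cast at h2
      exact h2
    have e1 : ρ ^ (-s) ≤ 2 ^ s * ((2 : ℝ) ^ k) ^ (-s) := by
      rw [Real.rpow_neg hρ0.le, Real.rpow_neg h2kR.le, ← div_eq_mul_inv,
        ← Real.div_rpow (by norm_num) h2kR.le, ← Real.inv_rpow hρ0.le]
      refine Real.rpow_le_rpow (by positivity) ?_ hs0
      rw [inv_le_comm₀ hρ0 (by positivity), inv_div]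
      linarith
    have e2 : ∏ i, ((1 + |((e.2 i - e'.2 i : ℤ) : ℝ)| / ρ) ^ 2)⁻¹ ≤ 4 ^ d * h (q e') := by
      have : (4 : ℝ) ^ d * h (q e') = ∏ i, (4 * ((1 + |((q e').2 i : ℝ)|) ^ 2)⁻¹) := by
        rw [Finset.prod_mul_distrib]
        simp [h]
      rw [this]
      refine Finset.prod_le_prod (fun i _ => by positivity) fun i _ => ?_
      have h1 : |((q e').2 i : ℝ)| ≤ |((e.2 i - e'.2 i : ℤ) : ℝ)| / ρ + 1 := by
        have h2 := abs_ediv_sub_le (x := e.2 i) (y := e'.2 i) h2k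
        refine h2.trans ?_
        gcongr
        exact_mod_cast hu'
      have h3 : (4 : ℝ) * ((1 + |((q e').2 i : ℝ)|) ^ 2)⁻¹ =
          (((1 + |((q e').2 i : ℝ)|) / 2) ^ 2)⁻¹ := by
        rw [div_pow, inv_div]
        ring
      rw [h3]
      have h4 : 0 ≤ |((e.2 i - e'.2 i : ℤ) : ℝ)| / ρ := by positivity
      gcongr
      linarith
    rw [corrWeight]
    calc _ ≤ (2 ^ s * ((2 : ℝ) ^ k) ^ (-s)) * (4 ^ d * h (q e')) :=
          mul_le_mul e1 e2 (Finset.prod_nonneg fun i _ => by positivity) (by positivity)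
      _ = _ := by ring
  have hcount : ∀ x ∈ F.image q, ((F.filter fun e' => q e' = x).card : ℝ) ≤ L * 2 ^ k := by
    intro x hx
    obtain ⟨e₀, h₀, rfl⟩ := Finset.mem_image.1 hx
    refine le_trans ?_ (card_filter_dyadic_le hk1 hkj hE hQ (hFE h₀))
    rw [Nat.cast_le]
    refine Finset.card_le_card fun e' he' => ?_
    obtain ⟨h1, h2⟩ := Finset.mem_filter.1 he'
    simp only [q, Prod.mk.injEq] at h2
    refine Finset.mem_filter.2 ⟨hFE h1, by linarith [h2.1], fun i => ?_⟩
    linarith [congrFun h2.2 i]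
  have himage : F.image q ⊆ Finset.Icc (-1) 1 ×ˢ (F.image q).image Prod.snd := by
    intro x hx
    refine Finset.mem_product.2 ⟨?_, Finset.mem_image_of_mem _ hx⟩
    obtain ⟨e', he', rfl⟩ := Finset.mem_image.1 hx
    have hu := abs_lt.1 (hF e' he').2
    have a1 := Int.ediv_mul_le (e'.1 : ℤ) h2k.ne'
    have a2 := Int.lt_ediv_add_one_mul_self (e'.1 : ℤ) h2k
    have a3 := Int.ediv_mul_le (e.1 : ℤ) h2k.ne'
    have a4 := Int.lt_ediv_add_one_mul_self (e.1 : ℤ) h2k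
    simp only [q, Finset.mem_Icc]
    constructor
    · by_contra hc
      nlinarith [not_le.1 hc]
    · by_contra hc
      nlinarith [not_le.1 hc]
  have hsum : ∑ e' ∈ F, h (q e') ≤ L * 2 ^ k * (3 * latSum ^ d) := by
    calc ∑ e' ∈ F, h (q e') = ∑ x ∈ F.image q, (F.filter fun e' => q e' = x).card • h x :=
          Finset.sum_comp h q
      _ ≤ ∑ x ∈ F.image q, L * 2 ^ k * h x := by
          refine Finset.sum_le_sum fun x hx => ?_
          rw [nsmul_eq_mul]
          exact mul_le_mul_of_nonneg_right (hcount x hx) (hh0 x)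
      _ = L * 2 ^ k * ∑ x ∈ F.image q, h x := by rw [Finset.mul_sum]
      _ ≤ L * 2 ^ k * (3 * latSum ^ d) := by
          gcongr
          calc _ ≤ ∑ x ∈ Finset.Icc (-1) 1 ×ˢ (F.image q).image Prod.snd, h x :=
                Finset.sum_le_sum_of_subset_of_nonneg himage fun x _ _ => hh0 x
            _ = 3 * ∑ ζ ∈ (F.image q).image Prod.snd, ∏ i, ((1 + |(ζ i : ℝ)|) ^ 2)⁻¹ := by
                rw [Finset.sum_product]
                simp [h]
            _ ≤ _ := by
                gcongr
                exact sum_prod_lattice_le _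
  calc _ ≤ ∑ e' ∈ F, (2 ^ s * ((2 : ℝ) ^ k) ^ (-s) * 4 ^ d) * h (q e') := Finset.sum_le_sum hW
    _ = (2 ^ s * ((2 : ℝ) ^ k) ^ (-s) * 4 ^ d) * ∑ e' ∈ F, h (q e') := by rw [Finset.mul_sum]
    _ ≤ (2 ^ s * ((2 : ℝ) ^ k) ^ (-s) * 4 ^ d) * (L * 2 ^ k * (3 * latSum ^ d)) := by gcongr
    _ = _ := by
        rw [sub_eq_add_neg, Real.rpow_add h2kR, Real.rpow_one]
        ring

end LatticeSums

section Summation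

variable {d : ℕ}

/-- The contribution of all points far away from `e` in the first coordinate. -/
lemma exists_sum_far_le (hd : 4 ≤ d) :
    ∃ A : ℝ, 0 ≤ A ∧ ∀ (j : ℕ) (L M : ℝ), 0 ≤ L → 1 ≤ M →
      ∀ E : Finset (ℕ × (Fin d → ℤ)),
      (∀ e ∈ E, (2 : ℝ) ^ j ≤ (e.1 : ℝ) ∧ (e.1 : ℝ) < 2 ^ (j + 1)) →
      (∀ Q : DyCube d j, (cubeCount (E.image (embedPt d)) Q : ℝ) ≤ L * Q.len) →
      ∀ e ∈ E, ∑ e' ∈ E with M < |(e'.1 : ℝ) - e.1|,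
        corrWeight ((e'.1 : ℝ) - e.1) (fun i => e.2 i - e'.2 i) ≤
          A * (L * M ^ (1 - ((d : ℝ) - 1) / 2)) := by
  set s := ((d : ℝ) - 1) / 2 with hs
  have hs1 : 1 < s := by
    have : (4 : ℝ) ≤ d := by exact_mod_cast hd
    rw [hs]
    linarith
  set q : ℝ := 2 ^ (1 - s) with hq
  have hq0 : 0 < q := by positivity
  have hq1 : q < 1 := Real.rpow_lt_one_of_one_lt_of_neg (by norm_num) (by linarith)
  have hqk : ∀ k : ℕ, ((2 : ℝ) ^ k) ^ (1 - s) = q ^ k := fun k => by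
    rw [hq, ← Real.rpow_natCast, ← Real.rpow_natCast, ← Real.rpow_mul (by norm_num),
      ← Real.rpow_mul (by norm_num), mul_comm]
  set B : ℝ := 2 ^ s * 4 ^ d * 3 * latSum ^ d with hB
  have hB0 : 0 ≤ B := by
    have := latSum_nonneg
    positivity
  refine ⟨B / (1 - q), div_nonneg hB0 (by linarith), fun j L M hL hM E hE hQ e he => ?_⟩
  set F := E.filter fun e' => M < |(e'.1 : ℝ) - e.1| with hF
  have hex : ∃ k : ℕ, M < 2 ^ k := pow_unbounded_of_one_lt M (by norm_num)
  set k₀ := Nat.find hex with hk₀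
  have hk₀M : M < 2 ^ k₀ := Nat.find_spec hex
  let κ : ℕ × (Fin d → ℤ) → ℕ := fun e' => Nat.size ((e'.1 : ℤ) - e.1).natAbs
  have hκ : ∀ e', ((2 : ℤ) ^ (κ e' - 1) ≤ |(e'.1 : ℤ) - e.1| ∨ κ e' = 0) ∧
      |(e'.1 : ℤ) - e.1| < 2 ^ κ e' := by
    intro e'
    constructor
    · rcases Nat.eq_zero_or_pos (κ e') with h | h
      · exact Or.inr h
      · left
        have : 2 ^ (κ e' - 1) ≤ ((e'.1 : ℤ) - e.1).natAbs :=
          Nat.lt_size.1 (Nat.sub_lt h one_pos)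
        rw [Int.abs_eq_natAbs]
        exact_mod_cast this
    · have : ((e'.1 : ℤ) - e.1).natAbs < 2 ^ κ e' := Nat.lt_size_self _
      rw [Int.abs_eq_natAbs]
      exact_mod_cast this
  have hcast : ∀ e' : ℕ × (Fin d → ℤ),
      |(e'.1 : ℝ) - e.1| = ((|(e'.1 : ℤ) - e.1| : ℤ) : ℝ) := fun e' => by push_cast; rfl
  have hmaps : ∀ e' ∈ F, κ e' ∈ Finset.Ico k₀ (j + 1) := by
    intro e' he'
    obtain ⟨h1, h2⟩ := Finset.mem_filter.1 he'
    refine Finset.mem_Ico.2 ⟨Nat.find_le ?_, Nat.lt_succ_of_le ?_⟩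
    · refine h2.trans ?_
      rw [hcast]
      exact_mod_cast (hκ e').2
    · refine Nat.size_le.2 ?_
      have a1 := hE e he
      have a2 := hE e' h1
      have a3 : |(e'.1 : ℝ) - e.1| < 2 ^ j := by
        rw [pow_succ] at a1 a2
        rw [abs_lt]
        constructor <;> linarith [a1.1, a1.2, a2.1, a2.2]
      rw [hcast, Int.abs_eq_natAbs] at a3
      exact_mod_cast a3
  rw [← Finset.sum_fiberwise_of_maps_to hmaps]
  have hk₀1 : 1 ≤ k₀ := by
    by_contra h
    have h0 : k₀ = 0 := by omega
    rw [h0, pow_zero] at hk₀M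
    linarith
  calc _ ≤ ∑ k ∈ Finset.Ico k₀ (j + 1), B * L * q ^ k := by
        refine Finset.sum_le_sum fun k hk => ?_
        obtain ⟨hk1, hk2⟩ := Finset.mem_Ico.1 hk
        rw [← hqk]
        refine sum_shell_le (hk₀1.trans hk1) (Nat.lt_succ_iff.1 hk2) (by omega) hL hE hQ e
          ((Finset.filter_subset _ _).trans (Finset.filter_subset _ _)) fun e' he' => ?_
        obtain ⟨-, h2⟩ := Finset.mem_filter.1 he'
        have := hκ e'
        rw [h2] at this
        exact ⟨this.1.resolve_right (by omega), this.2⟩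
    _ = B * L * ∑ k ∈ Finset.Ico k₀ (j + 1), q ^ k := (Finset.mul_sum _ _ _).symm
    _ ≤ B * L * (q ^ k₀ / (1 - q)) := by
        gcongr
        exact geom_sum_Ico_le_of_lt_one hq0.le hq1
    _ ≤ B * L * (M ^ (1 - s) / (1 - q)) := by
        have : q ^ k₀ ≤ M ^ (1 - s) := by
          rw [← hqk]
          exact Real.rpow_le_rpow_of_nonpos (by linarith) hk₀M.le (by linarith)
        have : 0 < 1 - q := by linarith
        gcongr
    _ = _ := by ring

/-- Almost orthogonality: near-diagonal blocks are treated with the Cauchy–Schwarz inequality,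
the remaining pairs by the pointwise bound on the inner products. -/
lemma norm_sq_sum_le {H : Type*} [NormedAddCommGroup H] [InnerProductSpace ℂ H]
    {X : Type*} (E : Finset (ℕ × X)) (u : ℕ × X → H) (w : ℕ × X → ℕ × X → ℝ)
    (hw : ∀ e e', ‖inner ℂ (u e) (u e')‖ ≤ w e e') {A B M : ℝ} (hM : 1 ≤ M)
    (hdiag : ∀ e ∈ E, ∑ e' ∈ E with e'.1 = e.1, w e e' ≤ A)
    (hfar : ∀ e ∈ E, ∑ e' ∈ E with M < |(e'.1 : ℝ) - e.1|, w e e' ≤ B) :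
    ‖∑ e ∈ E, u e‖ ^ 2 ≤ (3 * M * A + B) * E.card := by
  set N := E.image Prod.fst with hN
  let G : ℕ → H := fun n => ∑ e ∈ E with e.1 = n, u e
  let P : ℕ → ℕ → Prop := fun n n' => M < |(n' : ℝ) - n|
  have hP : ∀ n n', P n n' = P n' n := fun n n' => by simp only [P, abs_sub_comm]
  have hmaps : ∀ e ∈ E, e.1 ∈ N := fun e he => Finset.mem_image_of_mem _ he
  have hG : ∑ e ∈ E, u e = ∑ n ∈ N, G n := (Finset.sum_fiberwise_of_maps_to hmaps _).symm
  have hinner : ∀ n n', ‖inner ℂ (G n) (G n')‖ ≤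
      ∑ e ∈ E with e.1 = n, ∑ e' ∈ E with e'.1 = n', w e e' := by
    intro n n'
    simp only [G]
    rw [sum_inner]
    refine (norm_sum_le _ _).trans (Finset.sum_le_sum fun e _ => ?_)
    rw [inner_sum]
    exact (norm_sum_le _ _).trans (Finset.sum_le_sum fun e' _ => hw e e')
  have hGn : ∀ n, ‖G n‖ ^ 2 ≤ A * (E.filter fun e => e.1 = n).card := by
    intro n
    have h1 : ‖G n‖ ^ 2 = ‖inner ℂ (G n) (G n)‖ := by
      rw [inner_self_eq_norm_sq_to_K]
      simp
    rw [h1]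
    refine (hinner n n).trans ?_
    rw [mul_comm, ← nsmul_eq_mul]
    refine Finset.sum_le_card_nsmul _ _ _ fun e he => ?_
    obtain ⟨he1, rfl⟩ := Finset.mem_filter.1 he
    exact hdiag e he1
  have hcard : ∀ n : ℕ, ((N.filter fun n' => ¬ P n n').card : ℝ) ≤ 3 * M := by
    intro n
    have h1 : (N.filter fun n' => ¬ P n n').card ≤ 2 * ⌊M⌋₊ + 1 := by
      have h2 : (Finset.Icc (n - ⌊M⌋₊) (n + ⌊M⌋₊)).card ≤ 2 * ⌊M⌋₊ + 1 := by
        rw [Nat.card_Icc]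
        omega
      refine (Finset.card_le_card fun n' hn' => ?_).trans h2
      have h3 := not_lt.1 (Finset.mem_filter.1 hn').2
      have h4 : ((n' : ℤ) - n).natAbs ≤ ⌊M⌋₊ := by
        refine Nat.le_floor ?_
        rw [Nat.cast_natAbs]
        push_cast
        exact h3
      rw [Finset.mem_Icc]
      omega
    have h5 : ((2 * ⌊M⌋₊ + 1 : ℕ) : ℝ) ≤ 3 * M := by
      have := Nat.floor_le (zero_le_one.trans hM)
      push_cast
      linarith
    exact (Nat.cast_le.2 h1).trans h5
  have hsumcard : ∑ n ∈ N, ((E.filter fun e => e.1 = n).card : ℝ) = E.card := by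
    rw [Finset.card_eq_sum_card_fiberwise hmaps]
    push_cast
    rfl
  have hsumG : ∑ n ∈ N, ‖G n‖ ^ 2 ≤ A * E.card := by
    rw [← hsumcard, Finset.mul_sum]
    exact Finset.sum_le_sum fun n _ => hGn n
  have hnear : ∑ n ∈ N, ∑ n' ∈ N with ¬ P n n', ‖inner ℂ (G n) (G n')‖ ≤
      3 * M * A * E.card := by
    have h1 : ∑ n ∈ N, ∑ n' ∈ N with ¬ P n n', ‖G n‖ ^ 2 ≤ 3 * M * (A * E.card) := by
      calc _ ≤ ∑ n ∈ N, 3 * M * ‖G n‖ ^ 2 := by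
            refine Finset.sum_le_sum fun n _ => ?_
            rw [Finset.sum_const, nsmul_eq_mul]
            gcongr
            exact hcard n
        _ ≤ _ := by
            rw [← Finset.mul_sum]
            gcongr
    have h2 : ∑ n ∈ N, ∑ n' ∈ N with ¬ P n n', ‖G n'‖ ^ 2 =
        ∑ n ∈ N, ∑ n' ∈ N with ¬ P n n', ‖G n‖ ^ 2 := by
      simp only [Finset.sum_filter]
      rw [Finset.sum_comm]
      refine Finset.sum_congr rfl fun n _ => Finset.sum_congr rfl fun n' _ => ?_
      simp only [hP n n']
    calc _ ≤ ∑ n ∈ N, ∑ n' ∈ N with ¬ P n n', (‖G n‖ ^ 2 / 2 + ‖G n'‖ ^ 2 / 2) := by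
          refine Finset.sum_le_sum fun n _ => Finset.sum_le_sum fun n' _ => ?_
          refine (norm_inner_le_norm _ _).trans ?_
          nlinarith [sq_nonneg (‖G n‖ - ‖G n'‖)]
      _ = (∑ n ∈ N, ∑ n' ∈ N with ¬ P n n', ‖G n‖ ^ 2) / 2 +
          (∑ n ∈ N, ∑ n' ∈ N with ¬ P n n', ‖G n'‖ ^ 2) / 2 := by
          simp only [Finset.sum_add_distrib, Finset.sum_div]
      _ ≤ _ := by
          rw [h2]
          linarith
  have hfar' : ∑ n ∈ N, ∑ n' ∈ N with P n n', ‖inner ℂ (G n) (G n')‖ ≤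
      B * E.card := by
    have h1 : ∀ n ∈ N, ∑ n' ∈ N with P n n', ‖inner ℂ (G n) (G n')‖ ≤
        ∑ e ∈ E with e.1 = n, B := by
      intro n _
      refine (Finset.sum_le_sum fun n' _ => hinner n n').trans ?_
      rw [Finset.sum_comm]
      refine Finset.sum_le_sum fun e he => ?_
      obtain ⟨he1, rfl⟩ := Finset.mem_filter.1 he
      refine le_trans (le_of_eq ?_) (hfar e he1)
      rw [Finset.sum_filter (p := fun e' : ℕ × X => M < |(e'.1 : ℝ) - e.1|),
        ← Finset.sum_fiberwise_of_maps_to hmaps, Finset.sum_filter]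
      refine Finset.sum_congr rfl fun n' _ => ?_
      split_ifs with h
      · refine Finset.sum_congr rfl fun e' he' => ?_
        rw [if_pos]
        rwa [(Finset.mem_filter.1 he').2]
      · refine (Finset.sum_eq_zero fun e' he' => ?_).symm
        rw [if_neg]
        rwa [(Finset.mem_filter.1 he').2]
    refine (Finset.sum_le_sum h1).trans (le_of_eq ?_)
    rw [Finset.sum_fiberwise_of_maps_to hmaps, Finset.sum_const, nsmul_eq_mul, mul_comm]
  have h0 : ‖∑ e ∈ E, u e‖ ^ 2 ≤ ∑ n ∈ N, ∑ n' ∈ N, ‖inner ℂ (G n) (G n')‖ := by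
    have h1 : ‖∑ e ∈ E, u e‖ ^ 2 = ‖inner ℂ (∑ n ∈ N, G n) (∑ n ∈ N, G n)‖ := by
      rw [inner_self_eq_norm_sq_to_K, hG]
      simp
    rw [h1, sum_inner]
    refine (norm_sum_le _ _).trans (Finset.sum_le_sum fun n _ => ?_)
    rw [inner_sum]
    exact norm_sum_le _ _
  refine h0.trans ?_
  simp only [fun n => (Finset.sum_filter_add_sum_filter_not N (P n)
    fun n' => ‖inner ℂ (G n) (G n')‖).symm, Finset.sum_add_distrib]
  linarith

end Summation

/-- the single-scale `L²` estimate: under the density hypothesis,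
`‖∑_{(n,z) ∈ E_j} B_{n,z}‖₂² ≲ λ^{2p/(d-1)} #E_j`. -/
theorem statement15 (d : ℕ) (hd : 4 ≤ d) (a : Rd d → ℝ) (ha : IsDistFn a)
    (hcurv : CurvNondeg a) (η : ℝ → ℝ) (hη : IsBump η)
    (p : ℝ) (hp1 : 1 < p) (hp2 : p ≤ 2) :
    ∃ C : ℝ, 0 < C ∧ ∀ lam : ℝ, 2 ≤ lam → ∀ j : ℕ, 1 ≤ j →
      ∀ E : Finset (ℕ × (Fin d → ℤ)),
      (∀ e ∈ E, (2 : ℝ) ^ j ≤ (e.1 : ℝ) ∧ (e.1 : ℝ) < 2 ^ (j + 1)) →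
      (∀ Q : DyCube d j, (cubeCount (E.image (embedPt d)) Q : ℝ) ≤ lam ^ p * Q.len) →
      ∀ b : ℕ × (Fin d → ℤ) → Rd d → ℂ, (∀ e, IsNormalized e.2 (b e)) →
      eLpNorm (fun x : Rd d => ∑ e ∈ E, conv (Kker a η (e.1 : ℝ)) (b e) x) 2 volume
          ^ (2 : ℝ) ≤
        ENNReal.ofReal (C * lam ^ (2 * p / ((d : ℝ) - 1)) * (E.card : ℝ)) := by
  obtain ⟨C₀, hC₀, hvec⟩ := exists_vectors (by omega) ha hcurv hη
  obtain ⟨A, hA, hfar⟩ := exists_sum_far_le hd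
  have hlat := latSum_nonneg
  refine ⟨3 * (C₀ * latSum ^ d) + C₀ * A + 1, by positivity, fun lam hlam j _ E hE hQ b hb => ?_⟩
  obtain ⟨u, hu, hEu⟩ := hvec b hb
  have hlam0 : 0 ≤ lam := by linarith
  have hd' : (4 : ℝ) ≤ d := by exact_mod_cast hd
  set M : ℝ := lam ^ (2 * p / ((d : ℝ) - 1)) with hM
  have hM1 : 1 ≤ M := Real.one_le_rpow (by linarith) (div_nonneg (by linarith) (by linarith))
  have hLM : lam ^ p * M ^ (1 - ((d : ℝ) - 1) / 2) = M := by
    have h1 : lam ^ p = M ^ (((d : ℝ) - 1) / 2) := by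
      rw [hM, ← Real.rpow_mul hlam0]
      congr 1
      have : (d : ℝ) - 1 ≠ 0 := by linarith
      field_simp
    rw [h1, ← Real.rpow_add (by linarith)]
    simp
  have key := norm_sq_sum_le (A := C₀ * latSum ^ d) (B := C₀ * (A * M)) E u _ hu hM1
    (fun e _ => by
      rw [← Finset.mul_sum]
      gcongr
      refine le_trans (le_of_eq (Finset.sum_congr rfl fun e' he' => ?_))
        (sum_corrWeight_zero_le (E.filter fun e' => e'.1 = e.1) e.1
          (fun e' he' => (Finset.mem_filter.1 he').2) e.2)
      rw [(Finset.mem_filter.1 he').2, sub_self])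
    (fun e he => by
      rw [← Finset.mul_sum]
      gcongr
      have := hfar j (lam ^ p) M (by positivity) hM1 E hE hQ e he
      rwa [hLM] at this)
  rw [hEu, ENNReal.ofReal_rpow_of_nonneg (norm_nonneg _) zero_le_two]
  refine ENNReal.ofReal_le_ofReal ?_
  rw [Real.rpow_two]
  refine key.trans ?_
  gcongr
  nlinarith
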